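/- arXiv:0903.4917 — 2 statements merged into one kernel-verified Lean document; each statement's English description precedes it below -/
import Mathlib

section
/- If R is a semihereditary commutative ring, then the Laurent polynomial ring R[t₁,t₁⁻¹,...,tₙ,tₙ⁻¹] is coherent and regular, i.e., every finitely generated ideal is finitely presented and has finite projective dimension. -/
/-- A commutative ring is semihereditary if every finitely generated ideal is projective. -/
def IsSemihereditary (R : Type*) [CommRing R] : Prop :=
  ∀ I : Ideal R, I.FG → Module.Projective R I

/-- `HasFPD R n M` : the `R`-module `M` has projective dimension at most `n`. -/
def HasFPD (R : Type u) [CommRing R] : ℕ → ModuleCat.{u} R → Prop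
  | 0, M => Module.Projective R M
  | n + 1, M => ∃ (P : ModuleCat.{u} R) (f : P →ₗ[R] M),
      Module.Projective R P ∧ Function.Surjective f ∧
      HasFPD R n (ModuleCat.of R (LinearMap.ker f))

theorem LinearMap.nonempty_equiv_ker_prod {R M N : Type*} [CommRing R] [AddCommGroup M]
    [AddCommGroup N] [Module R M] [Module R N] [Module.Projective R N] (g : M →ₗ[R] N)
    (hg : Function.Surjective g) : Nonempty (M ≃ₗ[R] LinearMap.ker g × N) := by
  obtain ⟨σ, hσ⟩ := Module.projective_lifting_property g .id hg
  have hex : Function.Exact (LinearMap.ker g).subtype g := LinearMap.exact_subtype_ker_map _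
  obtain ⟨e, -, -⟩ := hex.splitSurjectiveEquiv (Submodule.injective_subtype _) ⟨σ, hσ⟩
  exact ⟨e⟩

namespace IsSemihereditary

variable {R : Type*} [CommRing R]

theorem exists_isIdempotentElem (hR : IsSemihereditary R) (a : R) :
    ∃ e : R, IsIdempotentElem e ∧ ∀ r, r * a = 0 ↔ r * e = r := by
  have := hR (Ideal.span {a}) (Submodule.fg_span_singleton a)
  let g : R →ₗ[R] Ideal.span {a} :=
    (LinearMap.toSpanSingleton R R a).codRestrict _ fun r => by
      simpa using Ideal.mul_mem_left _ r (Ideal.mem_span_singleton_self a)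
  have hg : Function.Surjective g := by
    rintro ⟨x, hx⟩
    obtain ⟨r, rfl⟩ := Ideal.mem_span_singleton'.1 hx
    exact ⟨r, Subtype.ext (by simp [g])⟩
  obtain ⟨σ, hσ⟩ := Module.projective_lifting_property g .id hg
  have hσ' (x : Ideal.span {a}) : σ x * a = x := by
    simpa [g] using congrArg Subtype.val (LinearMap.congr_fun hσ x)
  set a' : Ideal.span {a} := ⟨a, Ideal.mem_span_singleton_self a⟩
  have key (r : R) (hr : r * a = 0) : r * σ a' = 0 := by
    have : r • a' = 0 := Subtype.ext (by simpa [a'] using hr)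
    rw [← smul_eq_mul, ← map_smul, this, map_zero]
  have ha : (1 - σ a') * a = 0 := by rw [sub_mul, one_mul, hσ' a', sub_self]
  refine ⟨1 - σ a', ?_, fun r => ⟨fun h => ?_, fun h => ?_⟩⟩
  · have := key _ ha
    rw [IsIdempotentElem, mul_sub, this, mul_one, sub_zero]
  · rw [mul_sub, key r h, mul_one, sub_zero]
  · rw [← h, mul_assoc, ha, mul_zero]

theorem isReduced (hR : IsSemihereditary R) : IsReduced R := by
  refine (isReduced_iff_pow_one_lt 2 one_lt_two).2 fun a ha => ?_
  obtain ⟨e, he, hea⟩ := hR.exists_isIdempotentElem a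
  rw [← (hea a).1 (by rw [← sq, ha]), mul_comm, (hea e).2 he]

/-- An element of a minimal prime of a semihereditary ring is killed by an idempotent outside it. -/
theorem exists_mul_eq_zero_of_mem (hR : IsSemihereditary R) {p : Ideal R}
    (hp : p ∈ minimalPrimes R) {a : R} (ha : a ∈ p) :
    ∃ e, IsIdempotentElem e ∧ e ∉ p ∧ e * a = 0 := by
  have := hp.1.1
  obtain ⟨e, he, hea⟩ := hR.exists_isIdempotentElem a
  refine ⟨e, he, fun hep => ?_, (hea e).2 he⟩
  have h1 := IsLocalization.AtPrime.radical_map_of_mem_minimalPrimes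
    (A := Localization.AtPrime p) p ⊥ hp
  have h2 : algebraMap R (Localization.AtPrime p) a ∈ (⊥ : Ideal _).radical := by
    rw [← Ideal.map_bot (f := algebraMap R (Localization.AtPrime p)), h1]
    exact Ideal.mem_map_of_mem _ ha
  obtain ⟨n, hn⟩ := h2
  rw [Ideal.mem_bot, ← map_pow] at hn
  obtain ⟨⟨s, hs⟩, hsn⟩ := (IsLocalization.map_eq_zero_iff p.primeCompl _ _).1 hn
  have := hR.isReduced
  have hsa : s * a = 0 := by
    refine IsReduced.eq_zero _ ⟨n + 1, ?_⟩
    linear_combination (s ^ n * a) * hsn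
  exact hs ((hea s).1 hsa ▸ p.mul_mem_left s hep)

/-- Finitely generated submodules of free modules over a semihereditary ring are projective. -/
theorem projective_of_fg (hR : IsSemihereditary R) {E : Type*} (P : Submodule R (E →₀ R))
    (hP : P.FG) : Module.Projective R P := by
  classical
  suffices ∀ (T : Finset E) (P : Submodule R (E →₀ R)), P.FG →
      P ≤ Finsupp.supported R R (T : Set E) → Module.Projective R P by
    obtain ⟨S, rfl⟩ := hP
    refine this (S.biUnion Finsupp.support) _ ⟨S, rfl⟩ (Submodule.span_le.2 fun x hx => ?_)
    exact Finset.coe_subset.2 (Finset.subset_biUnion_of_mem _ hx)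
  intro T
  induction T using Finset.induction_on with
  | empty =>
    intro P _ hP
    have : Subsingleton P := by
      rw [Submodule.subsingleton_iff_eq_bot]
      simpa using hP
    infer_instance
  | insert a T _ ih =>
    intro P hPfg hP
    let g : P →ₗ[R] R := Finsupp.lapply a ∘ₗ P.subtype
    have : Module.Finite R P := Module.Finite.iff_fg.2 hPfg
    have hJ : Module.Projective R (LinearMap.range g) :=
      hR _ (Module.Finite.iff_fg.1 inferInstance)
    obtain ⟨e⟩ := LinearMap.nonempty_equiv_ker_prod (R := R) (M := P) (N := LinearMap.range g)
      (g := (g.rangeRestrict : P →ₗ[R] LinearMap.range g))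
      g.surjective_rangeRestrict
    have : Module.Finite R (LinearMap.ker g.rangeRestrict) :=
      Module.Finite.of_surjective (LinearMap.fst R _ _ ∘ₗ e.toLinearMap) fun x =>
        ⟨e.symm (x, 0), by simp⟩
    let i := P.subtype ∘ₗ (LinearMap.ker g.rangeRestrict).subtype
    have hi : Function.Injective i :=
      P.injective_subtype.comp (Submodule.injective_subtype _)
    have : Module.Projective R (LinearMap.range i) := by
      refine ih _ (Module.Finite.iff_fg.1 inferInstance) ?_
      rintro _ ⟨x, rfl⟩
      rw [Finsupp.mem_supported]
      intro b hb
      have hb' := hP x.1.2 hb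
      simp only [Finset.coe_insert, Set.mem_insert_iff] at hb'
      refine hb'.resolve_left ?_
      rintro rfl
      have : g x.1 = 0 := by simpa using x.2
      exact Finsupp.mem_support_iff.1 hb this
    have := Module.Projective.of_equiv' (LinearEquiv.ofInjective i hi).symm
    exact Module.Projective.of_equiv' e.symm

end IsSemihereditary

theorem finrank_map_add_finrank_inf_ker {K V W : Type*} [Field K] [AddCommGroup V] [Module K V]
    [AddCommGroup W] [Module K W] (M : Submodule K V) [FiniteDimensional K M] (f : V →ₗ[K] W) :
    Module.finrank K (M.map f) + Module.finrank K ↥(M ⊓ LinearMap.ker f) = Module.finrank K M := by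
  rw [← LinearMap.finrank_range_add_finrank_ker (f.domRestrict M), LinearMap.range_domRestrict]
  congr 1
  have : (LinearMap.ker (f.domRestrict M)).map M.subtype = M ⊓ LinearMap.ker f := by
    ext v
    simp [and_comm]
  rw [← this, Submodule.finrank_map_subtype_eq]

section LeadingExponents

variable {K E : Type*} [Field K] [LinearOrder E]

/-- The set of leading exponents of the elements of a space of finitely supported functions. -/
def leadingExponents (M : Submodule K (E →₀ K)) : Set E :=
  {e | ∃ g ∈ M, g e ≠ 0 ∧ ∀ e', e < e' → g e' = 0}

theorem leadingExponents_mono {M M' : Submodule K (E →₀ K)} (h : M ≤ M') :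
    leadingExponents M ⊆ leadingExponents M' :=
  fun _ ⟨g, hg, hge⟩ => ⟨g, h hg, hge⟩

theorem leadingExponents_subset {M : Submodule K (E →₀ K)} {T : Set E}
    (h : M ≤ Finsupp.supported K K T) : leadingExponents M ⊆ T :=
  fun _ ⟨_, hg, hge, _⟩ => h hg (Finsupp.mem_support_iff.2 hge)

theorem ncard_leadingExponents {M : Submodule K (E →₀ K)} {T : Finset E}
    (h : M ≤ Finsupp.supported K K (T : Set E)) :
    (leadingExponents M).ncard = Module.finrank K M := by
  induction T using Finset.induction_on_max generalizing M with
  | empty =>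
    have hM : M = ⊥ := by simpa using h
    subst hM
    have : leadingExponents (⊥ : Submodule K (E →₀ K)) = ∅ := by
      simpa using leadingExponents_subset h
    simp [this]
  | insert a T ha ih =>
    let ev : (E →₀ K) →ₗ[K] K := Finsupp.lapply a
    have hT : M ⊓ LinearMap.ker ev ≤ Finsupp.supported K K (T : Set E) := by
      rintro g ⟨hg, hga⟩ b hb
      have := h hg hb
      simp only [Finset.coe_insert, Set.mem_insert_iff] at this
      refine this.resolve_left ?_
      rintro rfl
      exact Finsupp.mem_support_iff.1 hb hga
    by_cases hker : M ≤ LinearMap.ker ev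
    · rw [inf_eq_left.2 hker] at hT
      exact ih hT
    · obtain ⟨g, hg, hga⟩ := SetLike.not_le_iff_exists.1 hker
      have hlead : leadingExponents M = insert a (leadingExponents (M ⊓ LinearMap.ker ev)) := by
        ext e
        constructor
        · rintro ⟨f, hf, hfe, hf'⟩
          by_cases hea : e = a
          · exact Or.inl hea
          · refine Or.inr ⟨f, ⟨hf, hf' a ?_⟩, hfe, hf'⟩
            have := h hf (Finsupp.mem_support_iff.2 hfe)
            simp only [Finset.coe_insert, Set.mem_insert_iff] at this
            exact ha e (this.resolve_left hea)
        · rintro (rfl | he)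
          · refine ⟨g, hg, hga, fun e' he' => ?_⟩
            by_contra hne
            have := h hg (Finsupp.mem_support_iff.2 hne)
            simp only [Finset.coe_insert, Set.mem_insert_iff] at this
            rcases this with rfl | this
            · exact lt_irrefl _ he'
            · exact lt_asymm he' (ha _ this)
          · exact leadingExponents_mono inf_le_left he
      have hsub := leadingExponents_subset hT
      rw [hlead, Set.ncard_insert_of_notMem (fun hmem => lt_irrefl _ (ha a (hsub hmem)))
        (T.finite_toSet.subset hsub), ih hT]
      have hfin : FiniteDimensional K
          (Finsupp.supported K K ((insert a T : Finset E) : Set E)) :=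
        Module.Finite.equiv (Finsupp.supportedEquivFinsupp _).symm
      have hfinM := Submodule.finiteDimensional_of_le h
      rw [← finrank_map_add_finrank_inf_ker M ev, add_comm, add_left_inj]
      have : M.map ev = ⊤ :=
        (eq_bot_or_eq_top (M.map ev : Ideal K)).resolve_left fun h0 =>
          hker (Submodule.map_le_iff_le_comap.1 h0.le)
      rw [this, finrank_top, Module.finrank_self]

theorem eq_of_leadingExponents_subset {M M' : Submodule K (E →₀ K)} {T : Finset E} (hle : M ≤ M')
    (h : M' ≤ Finsupp.supported K K (T : Set E))
    (hsub : leadingExponents M' ⊆ leadingExponents M) : M = M' := by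
  have hfin : FiniteDimensional K (Finsupp.supported K K (T : Set E)) :=
    Module.Finite.equiv (Finsupp.supportedEquivFinsupp _).symm
  have hfinM : FiniteDimensional K M' := Submodule.finiteDimensional_of_le h
  refine Submodule.eq_of_le_of_finrank_eq hle ?_
  rw [← ncard_leadingExponents h, ← ncard_leadingExponents (hle.trans h),
    (leadingExponents_mono hle).antisymm hsub]

end LeadingExponents

section Level

variable {G E σ : Type*} [AddCommMonoid G] [AddAction G E] [DecidableEq E] [Fintype σ]

/-- The elements obtained from `E₀` by applying exactly `d` of the translations by the `x j`. -/
def level (x : σ → G) (E₀ : Finset E) : ℕ → Finset E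
  | 0 => E₀
  | d + 1 => Finset.univ.biUnion fun j => (level x E₀ d).image (x j +ᵥ ·)

/-- A family of subsets of the levels which is carried into itself by the translations. -/
structure IsStableFamily (x : σ → G) (E₀ : Finset E) (U : ℕ → Set E) : Prop where
  subset_level (d : ℕ) : U d ⊆ level x E₀ d
  vadd_mem (d : ℕ) (j : σ) {e : E} : e ∈ U d → x j +ᵥ e ∈ U (d + 1)

/-- From index `D` on, the family is obtained from its preceding member by translations. -/
def GeneratedFrom (x : σ → G) (U : ℕ → Set E) (D : ℕ) : Prop :=
  ∀ d, D ≤ d → ∀ e ∈ U (d + 1), ∃ j, ∃ e' ∈ U d, x j +ᵥ e' = e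

variable {x : σ → G} {E₀ : Finset E}

theorem vadd_mem_level {d : ℕ} (j : σ) {e : E} (he : e ∈ level x E₀ d) :
    x j +ᵥ e ∈ level x E₀ (d + 1) :=
  Finset.mem_biUnion.2 ⟨j, Finset.mem_univ _, Finset.mem_image_of_mem _ he⟩

theorem exists_of_mem_level {d : ℕ} {e : E} (he : e ∈ level x E₀ d) :
    ∃ e₀ ∈ E₀, ∃ m : σ →₀ ℕ, m.degree = d ∧ m.linearCombination ℕ x +ᵥ e₀ = e := by
  induction d generalizing e with
  | zero => exact ⟨e, he, 0, by simp, by simp⟩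
  | succ d ih =>
    obtain ⟨j, -, he⟩ := Finset.mem_biUnion.1 he
    obtain ⟨e', he', rfl⟩ := Finset.mem_image.1 he
    obtain ⟨e₀, he₀, m, rfl, rfl⟩ := ih he'
    refine ⟨e₀, he₀, Finsupp.single j 1 + m, ?_, ?_⟩
    · rw [map_add, Finsupp.degree_single, add_comm]
    · simp [add_vadd]

theorem IsStableFamily.exists_generatedFrom {U : ℕ → Set E} (hU : IsStableFamily x E₀ U) :
    ∃ D, GeneratedFrom x U D := by
  let V (e₀ : E) : Set (σ →₀ ℕ) := {m | Finsupp.linearCombination ℕ x m +ᵥ e₀ ∈ U m.degree}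
  have hV (e₀ : E) (m n : σ →₀ ℕ) (hm : m ∈ V e₀) : n + m ∈ V e₀ := by
    induction n using Finsupp.induction_linear generalizing m with
    | zero => simpa
    | add f g hf hg => rw [add_assoc]; exact hf _ (hg _ hm)
    | single j k =>
      induction k generalizing m with
      | zero => simpa
      | succ k ih =>
        rw [Finsupp.single_add, add_assoc]
        refine ih _ ?_
        have := hU.vadd_mem _ j hm
        simpa [V, add_vadd, add_comm] using this
  have hfin (e₀ : E) : {m | Minimal (· ∈ V e₀) m}.Finite :=
    WellQuasiOrderedLE.finite_of_isAntichain (setOfPred_minimal_antichain _)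
  let D := E₀.sup fun e₀ => (hfin e₀).toFinset.sup Finsupp.degree
  refine ⟨D, fun d hd e he => ?_⟩
  obtain ⟨e₀, he₀, m, hmd, rfl⟩ := exists_of_mem_level (hU.subset_level _ he)
  have hm : m ∈ V e₀ := by
    change _ ∈ U m.degree
    rwa [hmd]
  obtain ⟨m₀, hm₀, hmin⟩ := exists_minimal_le_of_wellFoundedLT (· ∈ V e₀) m hm
  have hdeg : m₀.degree ≤ D := by
    refine le_trans ?_ (Finset.le_sup (f := fun e₀ => (hfin e₀).toFinset.sup Finsupp.degree) he₀)
    exact Finset.le_sup (f := Finsupp.degree) ((hfin e₀).mem_toFinset.2 hmin)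
  obtain ⟨j, hj⟩ : ∃ j, m₀ j < m j := by
    by_contra! hcon
    have : m = m₀ := le_antisymm hcon hm₀
    subst this
    omega
  obtain ⟨m', rfl⟩ : ∃ m', m = Finsupp.single j 1 + (m' + m₀) := by
    have h1 : m₀ + Finsupp.single j 1 ≤ m := by
      intro i
      by_cases hi : i = j
      · subst hi; simpa using hj
      · simpa [Finsupp.single_apply, Ne.symm hi] using hm₀ i
    obtain ⟨m', rfl⟩ := exists_add_of_le h1
    exact ⟨m', by abel⟩
  refine ⟨j, Finsupp.linearCombination ℕ x (m' + m₀) +ᵥ e₀, ?_, ?_⟩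
  · have := hV e₀ m₀ m' hmin.1
    have h2 : (m' + m₀).degree = d := by
      rw [map_add, Finsupp.degree_single] at hmd
      omega
    simpa [V, h2] using this
  · simp [add_vadd]

/-- For families with prescribed cardinalities there is a uniform bound for the generation. -/
theorem exists_forall_generatedFrom (x : σ → G) (E₀ : Finset E) (h : ℕ → ℕ) :
    ∃ D, ∀ U : ℕ → Set E, IsStableFamily x E₀ U → (∀ d, (U d).ncard = h d) →
      GeneratedFrom x U D := by
  by_contra! hcon
  choose U hU hcard hgen using hcon
  let 𝓤 : Filter ℕ := Filter.hyperfilter ℕ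
  let W : ℕ → Set E := fun d => {e | ∀ᶠ D in 𝓤, e ∈ U D d}
  have hW (d : ℕ) : ∀ᶠ D in 𝓤, U D d = W d := by
    have : ∀ᶠ D in 𝓤, ∀ e ∈ level x E₀ d, (e ∈ U D d ↔ e ∈ W d) := by
      rw [Filter.eventually_all_finset]
      intro e _
      by_cases he : e ∈ W d
      · filter_upwards [he] with D hD using iff_of_true hD he
      · filter_upwards [Ultrafilter.eventually_not.2 he] with D hD using iff_of_false hD he
    have hsub : W d ⊆ level x E₀ d := fun e he => by
      obtain ⟨D, hD⟩ := Filter.Eventually.exists he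
      exact (hU D).subset_level d hD
    filter_upwards [this] with D hD
    ext e
    exact ⟨fun he => (hD e ((hU D).subset_level d he)).1 he, fun he => (hD e (hsub he)).2 he⟩
  have hWs : IsStableFamily x E₀ W :=
    ⟨fun d e he => by
      obtain ⟨D, hD⟩ := Filter.Eventually.exists he
      exact (hU D).subset_level d hD,
     fun d j e he => by
      filter_upwards [he] with D hD using (hU D).vadd_mem d j hD⟩
  have hWcard (d : ℕ) : (W d).ncard = h d := by
    obtain ⟨D, hD⟩ := (hW d).exists
    rw [← hD, hcard]
  obtain ⟨D₀, hD₀⟩ := hWs.exists_generatedFrom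
  obtain ⟨D, hD, hle⟩ := ((hW D₀).and
    ((Filter.eventually_ge_atTop D₀).filter_mono Nat.hyperfilter_le_atTop)).exists
  have hsub : ∀ d, D₀ ≤ d → W d ⊆ U D d := by
    intro d hd
    induction d, hd using Nat.le_induction with
    | base => exact hD.ge
    | succ d hd ih =>
      intro e he
      obtain ⟨j, e', he', rfl⟩ := hD₀ d hd e he
      exact (hU D).vadd_mem d j (ih he')
  have heq (d : ℕ) (hd : D₀ ≤ d) : W d = U D d :=
    Set.eq_of_subset_of_ncard_le (hsub d hd) (by rw [hcard, hWcard])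
      ((level x E₀ d).finite_toSet.subset ((hU D).subset_level d))
  refine hgen D fun d hd e he => ?_
  rw [← heq d (hle.trans hd)]
  rw [← heq (d + 1) (by omega)] at he
  exact hD₀ d (hle.trans hd) e he

end Level

section FiberSpan

variable {R E E' : Type*} [CommRing R] (K : Type*) [Field K] [Algebra R K]

/-- Coefficientwise application of the structure map of an algebra. -/
noncomputable def coeffMap (E : Type*) : (E →₀ R) →ₗ[R] (E →₀ K) :=
  Finsupp.mapRange.linearMap (Algebra.linearMap R K)

@[simp]
theorem coeffMap_apply (y : E →₀ R) (e : E) : coeffMap K E y e = algebraMap R K (y e) := rfl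

/-- The `K`-span of the image of a submodule of `E →₀ R` in `E →₀ K`. -/
noncomputable def fiberSpan (P : Submodule R (E →₀ R)) : Submodule K (E →₀ K) :=
  Submodule.span K (coeffMap K E '' (P : Set (E →₀ R)))

variable {K}

theorem coeffMap_mem_fiberSpan {P : Submodule R (E →₀ R)} {y : E →₀ R} (hy : y ∈ P) :
    coeffMap K E y ∈ fiberSpan K P :=
  Submodule.subset_span ⟨y, hy, rfl⟩

theorem fiberSpan_mono {P P' : Submodule R (E →₀ R)} (h : P ≤ P') :
    fiberSpan K P ≤ fiberSpan K P' :=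
  Submodule.span_mono (Set.image_mono h)

theorem fiberSpan_le_supported {P : Submodule R (E →₀ R)} {T : Set E}
    (h : P ≤ Finsupp.supported R R T) : fiberSpan K P ≤ Finsupp.supported K K T := by
  refine Submodule.span_le.2 ?_
  rintro _ ⟨y, hy, rfl⟩ e he
  refine h hy (Finsupp.mem_support_iff.2 fun h0 => Finsupp.mem_support_iff.1 he ?_)
  simp [h0]

theorem fiberSpan_supported (T : Set E) :
    fiberSpan K (Finsupp.supported R R T) = Finsupp.supported K K T := by
  refine le_antisymm (fiberSpan_le_supported le_rfl) ?_
  rw [Finsupp.supported_eq_span_single]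
  refine Submodule.span_mono ?_
  rintro _ ⟨e, he, rfl⟩
  exact ⟨Finsupp.single e 1, Finsupp.single_mem_supported R 1 he, by simp [coeffMap]⟩

/-- The extension of scalars of a linear map between free modules. -/
noncomputable def extendMap (φ : (E →₀ R) →ₗ[R] (E' →₀ R)) : (E →₀ K) →ₗ[K] (E' →₀ K) :=
  Finsupp.linearCombination K fun e => coeffMap K E' (φ (Finsupp.single e 1))

theorem extendMap_coeffMap (φ : (E →₀ R) →ₗ[R] (E' →₀ R)) (y : E →₀ R) :
    extendMap (K := K) φ (coeffMap K E y) = coeffMap K E' (φ y) := by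
  suffices (extendMap (K := K) φ).restrictScalars R ∘ₗ coeffMap K E = coeffMap K E' ∘ₗ φ from
    LinearMap.congr_fun this y
  ext e : 2
  simp [extendMap, coeffMap]

theorem map_fiberSpan (φ : (E →₀ R) →ₗ[R] (E' →₀ R)) (P : Submodule R (E →₀ R)) :
    (fiberSpan K P).map (extendMap φ) = fiberSpan K (P.map φ) := by
  rw [fiberSpan, Submodule.map_span, fiberSpan, Submodule.map_coe, Set.image_image, Set.image_image]
  simp_rw [extendMap_coeffMap]

theorem extendMap_lmapDomain (t : E → E') :
    extendMap (K := K) (Finsupp.lmapDomain R R t) = Finsupp.lmapDomain K K t := by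
  ext e : 2
  simp [extendMap, coeffMap, Finsupp.mapDomain_single]

theorem fiberSpan_map_lmapDomain (t : E → E') (P : Submodule R (E →₀ R)) :
    fiberSpan K (P.map (Finsupp.lmapDomain R R t)) =
      (fiberSpan K P).map (Finsupp.lmapDomain K K t) := by
  rw [← map_fiberSpan, extendMap_lmapDomain]

end FiberSpan

theorem mem_leadingExponents_map {K E : Type*} [Field K] [LinearOrder E] {t : E → E}
    (ht : StrictMono t) {M : Submodule K (E →₀ K)} {e : E} (he : e ∈ leadingExponents M) :
    t e ∈ leadingExponents (M.map (Finsupp.lmapDomain K K t)) := by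
  obtain ⟨g, hg, hge, hg'⟩ := he
  refine ⟨_, Submodule.mem_map_of_mem hg, ?_, fun e' he' => ?_⟩
  · rwa [Finsupp.lmapDomain_apply, Finsupp.mapDomain_apply ht.injective]
  · rw [Finsupp.lmapDomain_apply]
    by_cases h : e' ∈ Set.range t
    · obtain ⟨e'', rfl⟩ := h
      rw [Finsupp.mapDomain_apply ht.injective]
      exact hg' _ (ht.lt_iff_lt.1 he')
    · exact Finsupp.mapDomain_of_notMem_range _ _ h

section ResidueField

variable {R E : Type*} [CommRing R] (q : Ideal R) [q.IsPrime]

theorem exists_coeffMap_eq_smul {P : Submodule R (E →₀ R)} {z : E →₀ q.ResidueField}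
    (hz : z ∈ fiberSpan q.ResidueField P) :
    ∃ s ∉ q, ∃ y ∈ P, coeffMap q.ResidueField E y = s • z := by
  induction hz using Submodule.span_induction with
  | mem z hz =>
    obtain ⟨y, hy, rfl⟩ := hz
    exact ⟨1, (Ideal.ne_top_iff_one q).1 ‹q.IsPrime›.ne_top, y, hy, (one_smul _ _).symm⟩
  | zero => exact ⟨1, (Ideal.ne_top_iff_one q).1 ‹q.IsPrime›.ne_top, 0, P.zero_mem, by simp⟩
  | add z z' _ _ h h' =>
    obtain ⟨s, hs, y, hy, hyz⟩ := h
    obtain ⟨s', hs', y', hy', hyz'⟩ := h'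
    refine ⟨s * s', fun h => (‹q.IsPrime›.mem_or_mem h).elim hs hs', s' • y + s • y',
      P.add_mem (P.smul_mem _ hy) (P.smul_mem _ hy'), ?_⟩
    rw [map_add, map_smul, map_smul, hyz, hyz', smul_add, smul_smul, smul_smul, mul_comm s']
  | smul c z _ h =>
    obtain ⟨s, hs, y, hy, hyz⟩ := h
    obtain ⟨a, b, hb, rfl⟩ := IsFractionRing.div_surjective (A := R ⧸ q) c
    obtain ⟨a, rfl⟩ := Ideal.Quotient.mk_surjective a
    obtain ⟨b, rfl⟩ := Ideal.Quotient.mk_surjective b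
    have hb' : b ∉ q := fun h => nonZeroDivisors.ne_zero hb (Ideal.Quotient.eq_zero_iff_mem.2 h)
    refine ⟨b * s, fun h => (‹q.IsPrime›.mem_or_mem h).elim hb' hs, a • y, P.smul_mem _ hy, ?_⟩
    have h1 (r : R) : algebraMap (R ⧸ q) q.ResidueField (Ideal.Quotient.mk q r) =
      algebraMap R q.ResidueField r := rfl
    have h2 : algebraMap R q.ResidueField b ≠ 0 := by
      rwa [Ne, Ideal.algebraMap_residueField_eq_zero]
    rw [map_smul, hyz, h1, h1]
    ext e
    simp only [Finsupp.smul_apply, Algebra.smul_def, map_mul, Algebra.algebraMap_self_apply]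
    field_simp

theorem mem_fiberSpan_of_smul_mem {P : Submodule R (E →₀ R)} {z : E →₀ q.ResidueField} {s : R}
    (hs : s ∉ q) (hz : s • z ∈ fiberSpan q.ResidueField P) : z ∈ fiberSpan q.ResidueField P := by
  rw [← algebraMap_smul q.ResidueField s z] at hz
  rwa [Submodule.smul_mem_iff] at hz
  rwa [Ne, Ideal.algebraMap_residueField_eq_zero]

end ResidueField

open Topology

namespace IsSemihereditary

variable {R : Type*} [CommRing R] (hR : IsSemihereditary R)

include hR

theorem eventually_mem {p : PrimeSpectrum R} (hp : p.asIdeal ∈ minimalPrimes R) {a : R}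
    (ha : a ∈ p.asIdeal) : ∀ᶠ q in 𝓝 p, a ∈ q.asIdeal := by
  obtain ⟨e, -, hep, hea⟩ := hR.exists_mul_eq_zero_of_mem hp ha
  filter_upwards [(PrimeSpectrum.basicOpen e).isOpen.mem_nhds hep] with q hq
  exact (q.isPrime.mem_or_mem (hea ▸ q.asIdeal.zero_mem)).resolve_left hq

/-- A property that holds near a minimal prime `p` holds at all minimal primes below the points
of a neighbourhood of a given point in the closure of `p`. -/
theorem eventually_forall_minimalPrimes {p : PrimeSpectrum R} {s : PrimeSpectrum R → Prop}
    (hs : ∀ᶠ q in 𝓝 p, s q)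
    {q₀ : PrimeSpectrum R} (hpq : p ≤ q₀) :
    ∀ᶠ q in 𝓝 q₀, ∀ p' : PrimeSpectrum R, p'.asIdeal ∈ minimalPrimes R → p' ≤ q → s p' := by
  obtain ⟨_, ⟨a, rfl⟩, hap, has⟩ :=
    PrimeSpectrum.isTopologicalBasis_basic_opens.mem_nhds_iff.1 hs
  obtain ⟨e, he, hea⟩ := hR.exists_isIdempotentElem a
  have hep : e ∈ p.asIdeal :=
    (p.isPrime.mem_or_mem (((hea e).2 he).symm ▸ p.asIdeal.zero_mem)).resolve_right hap
  have he1 {q : PrimeSpectrum R} (h : e ∈ q.asIdeal) : 1 - e ∉ q.asIdeal := fun h1 =>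
    (Ideal.ne_top_iff_one _).1 q.isPrime.ne_top (by simpa using q.asIdeal.add_mem h1 h)
  filter_upwards [(PrimeSpectrum.basicOpen (1 - e)).isOpen.mem_nhds (he1 (hpq hep))]
    with q hq p' hp' hpq'
  refine has fun hap' => ?_
  obtain ⟨c, -, hcp, hca⟩ := hR.exists_mul_eq_zero_of_mem hp' hap'
  refine hq (hpq' ((p'.isPrime.mem_or_mem ?_).resolve_left hcp))
  rw [mul_sub, (hea c).1 hca, mul_one, sub_self]
  exact p'.asIdeal.zero_mem

variable {E : Type*} {p : PrimeSpectrum R} (hp : p.asIdeal ∈ minimalPrimes R)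

include hp

theorem eventually_leadingExponents_subset [LinearOrder E] {P : Submodule R (E →₀ R)}
    {T : Finset E} (hP : P ≤ Finsupp.supported R R (T : Set E)) :
    ∀ᶠ q in 𝓝 p, leadingExponents (fiberSpan p.asIdeal.ResidueField P) ⊆
      leadingExponents (fiberSpan q.asIdeal.ResidueField P) := by
  refine (Set.Finite.eventually_all (T.finite_toSet.subset
    (leadingExponents_subset (fiberSpan_le_supported hP)))).2 ?_
  rintro e ⟨z, hz, hze, hz'⟩
  obtain ⟨s, hs, y, hy, hyz⟩ := exists_coeffMap_eq_smul p.asIdeal hz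
  have hyz' (e : E) : algebraMap R p.asIdeal.ResidueField (y e) = s • z e :=
    DFunLike.congr_fun hyz e
  have h1 : y e ∉ p.asIdeal := by
    rw [← Ideal.algebraMap_residueField_eq_zero, hyz', Algebra.smul_def]
    refine mul_ne_zero ?_ hze
    rwa [Ne, Ideal.algebraMap_residueField_eq_zero]
  have h2 : ∀ᶠ q : PrimeSpectrum R in 𝓝 p, ∀ e' ∈ y.support, e < e' → y e' ∈ q.asIdeal := by
    rw [Filter.eventually_all_finset]
    intro e' _
    by_cases he' : e < e'
    · refine (hR.eventually_mem hp ?_).mono fun q hq _ => hq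
      rw [← Ideal.algebraMap_residueField_eq_zero, hyz', hz' e' he', smul_zero]
    · exact .of_forall fun q h => absurd h he'
  filter_upwards [h2, (PrimeSpectrum.basicOpen (y e)).isOpen.mem_nhds h1] with q hq hqe
  refine ⟨_, coeffMap_mem_fiberSpan hy, ?_, fun e' he' => ?_⟩
  · rwa [coeffMap_apply, Ne, Ideal.algebraMap_residueField_eq_zero]
  · rw [coeffMap_apply, Ideal.algebraMap_residueField_eq_zero]
    by_cases h : e' ∈ y.support
    · exact hq e' h he'
    · rw [Finsupp.notMem_support_iff.1 h]
      exact q.asIdeal.zero_mem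

theorem fiberSpan_ker_inf {E' : Type*} (φ : (E →₀ R) →ₗ[R] (E' →₀ R)) (T : Set E) :
    fiberSpan p.asIdeal.ResidueField (LinearMap.ker φ ⊓ Finsupp.supported R R T) =
      Finsupp.supported _ _ T ⊓ LinearMap.ker (extendMap (K := p.asIdeal.ResidueField) φ) := by
  refine le_antisymm (le_inf (fiberSpan_le_supported inf_le_right) ?_) ?_
  · refine Submodule.span_le.2 ?_
    rintro _ ⟨y, hy, rfl⟩
    change extendMap _ _ = 0
    rw [extendMap_coeffMap, show φ y = 0 from hy.1, map_zero]
  · classical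
    rintro z ⟨hz, hzφ⟩
    rw [SetLike.mem_coe, ← fiberSpan_supported (R := R)] at hz
    obtain ⟨s, hs, y, hy, hyz⟩ := exists_coeffMap_eq_smul p.asIdeal hz
    have hφ : coeffMap p.asIdeal.ResidueField E' (φ y) = 0 := by
      rw [← extendMap_coeffMap, hyz, ← algebraMap_smul p.asIdeal.ResidueField s z, map_smul,
        show extendMap _ z = 0 from hzφ, smul_zero]
    obtain ⟨c, hc, hcφ⟩ : ∃ c ∉ p.asIdeal, ∀ e ∈ (φ y).support, c * φ y e = 0 := by
      have (e : E') : ∃ c ∉ p.asIdeal, c * φ y e = 0 := by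
        obtain ⟨c, -, hc⟩ := hR.exists_mul_eq_zero_of_mem hp
          (a := φ y e) (Ideal.algebraMap_residueField_eq_zero.1 (DFunLike.congr_fun hφ e))
        exact ⟨c, hc⟩
      choose c hc hcφ using this
      refine ⟨∏ e ∈ (φ y).support, c e, ?_, fun e he => ?_⟩
      · rw [Ideal.IsPrime.prod_mem_iff]
        rintro ⟨e, -, h⟩
        exact hc e h
      · rw [← Finset.mul_prod_erase _ _ he, mul_right_comm, hcφ, zero_mul]
    have hker : c • y ∈ LinearMap.ker φ := by
      rw [LinearMap.mem_ker, map_smul]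
      ext e
      by_cases he : e ∈ (φ y).support
      · exact hcφ e he
      · simp [Finsupp.notMem_support_iff.1 he]
    have := coeffMap_mem_fiberSpan (K := p.asIdeal.ResidueField)
      (show c • y ∈ LinearMap.ker φ ⊓ Finsupp.supported R R T from
        ⟨hker, Submodule.smul_mem _ c hy⟩)
    rw [map_smul, hyz] at this
    exact mem_fiberSpan_of_smul_mem _ hs (mem_fiberSpan_of_smul_mem _ hc this)

theorem ncard_leadingExponents_add {E' : Type*} [LinearOrder E] [LinearOrder E']
    (φ : (E →₀ R) →ₗ[R] (E' →₀ R)) (T : Finset E) (T' : Finset E')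
    (hT : (Finsupp.supported R R (T : Set E)).map φ ≤ Finsupp.supported R R (T' : Set E')) :
    (leadingExponents (fiberSpan p.asIdeal.ResidueField
        (LinearMap.ker φ ⊓ Finsupp.supported R R (T : Set E)))).ncard +
      (leadingExponents (fiberSpan p.asIdeal.ResidueField
        ((Finsupp.supported R R (T : Set E)).map φ))).ncard = T.card := by
  rw [ncard_leadingExponents (fiberSpan_le_supported hT),
    ncard_leadingExponents (fiberSpan_le_supported inf_le_right), ← map_fiberSpan,
    fiberSpan_supported, hR.fiberSpan_ker_inf hp, add_comm]
  have e := Finsupp.supportedEquivFinsupp (M := p.asIdeal.ResidueField)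
    (R := p.asIdeal.ResidueField) (T : Set E)
  have : FiniteDimensional p.asIdeal.ResidueField
      (Finsupp.supported p.asIdeal.ResidueField p.asIdeal.ResidueField (T : Set E)) :=
    Module.Finite.equiv e.symm
  rw [finrank_map_add_finrank_inf_ker, e.finrank_eq]
  simp

end IsSemihereditary

open TensorProduct

section Retraction

variable {R E : Type*} [CommRing R] {N : Submodule R (E →₀ R)} (π : (E →₀ R) →ₗ[R] N)
  (hπ : ∀ y : N, π y = y)

include hπ

theorem finrank_fiberSpan_eq_rankAtStalk [Module.Finite R N] (q : PrimeSpectrum R) :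
    Module.finrank q.asIdeal.ResidueField (fiberSpan q.asIdeal.ResidueField N) =
      Module.rankAtStalk N q := by
  have : Module.Projective R N := Module.Projective.of_split N.subtype π (LinearMap.ext hπ)
  let K := q.asIdeal.ResidueField
  let L : K ⊗[R] N →ₗ[K] (E →₀ K) := LinearMap.liftBaseChange K (coeffMap K E ∘ₗ N.subtype)
  let π' : (E →₀ K) →ₗ[K] K ⊗[R] N :=
    Finsupp.linearCombination K fun e => 1 ⊗ₜ π (Finsupp.single e 1)
  have hπ' (y : E →₀ R) : π' (coeffMap K E y) = 1 ⊗ₜ π y := by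
    suffices π'.restrictScalars R ∘ₗ coeffMap K E = TensorProduct.mk R K N 1 ∘ₗ π from
      LinearMap.congr_fun this y
    ext e : 2
    simp [π', coeffMap]
  have hL : Function.LeftInverse π' L := by
    intro z
    suffices π' ∘ₗ L = LinearMap.id from LinearMap.congr_fun this z
    ext y
    simp [L, hπ', hπ]
  have hrange : LinearMap.range L = fiberSpan K N := by
    refine le_antisymm ?_ (Submodule.span_le.2 ?_)
    · rintro _ ⟨z, rfl⟩
      induction z using TensorProduct.induction_on with
      | zero => simp
      | add z z' h h' => rw [map_add]; exact Submodule.add_mem _ h h'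
      | tmul c y =>
        rw [LinearMap.liftBaseChange_tmul]
        exact Submodule.smul_mem _ c (coeffMap_mem_fiberSpan y.2)
    · rintro _ ⟨y, hy, rfl⟩
      exact ⟨1 ⊗ₜ ⟨y, hy⟩, by simp [L]⟩
  rw [Module.rankAtStalk_eq, ← hrange]
  exact (LinearEquiv.ofInjective L hL.injective).finrank_eq.symm

theorem finrank_fiberSpan_eq_of_le [Module.Finite R N] {p q : PrimeSpectrum R} (hpq : p ≤ q) :
    Module.finrank p.asIdeal.ResidueField (fiberSpan p.asIdeal.ResidueField N) =
      Module.finrank q.asIdeal.ResidueField (fiberSpan q.asIdeal.ResidueField N) := by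
  have : Module.Projective R N := Module.Projective.of_split N.subtype π (LinearMap.ext hπ)
  rw [finrank_fiberSpan_eq_rankAtStalk π hπ, finrank_fiberSpan_eq_rankAtStalk π hπ,
    Module.rankAtStalk_eq_of_le_of_finite_of_flat _ hpq]

theorem le_of_forall_fiberSpan_le [Module.Finite R N] {Q : Submodule R (E →₀ R)} (hQ : Q ≤ N)
    (h : ∀ (q : Ideal R) [q.IsMaximal], fiberSpan q.ResidueField N ≤ fiberSpan q.ResidueField Q) :
    N ≤ Q := by
  intro y hy
  have htop : Q.comap (LinearMap.toSpanSingleton R _ y) = (⊤ : Ideal R) := by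
    by_contra hne
    obtain ⟨q, hq, hle⟩ := Ideal.exists_le_maximal _ hne
    have hN : N ≤ Q ⊔ q • N := by
      intro z hz
      obtain ⟨s, hs, y', hy', hyz⟩ :=
        exists_coeffMap_eq_smul q (h q (coeffMap_mem_fiberSpan hz))
      rw [← map_smul, ← sub_eq_zero, ← map_sub] at hyz
      have hmem : y' - s • z ∈ q • N := by
        have h1 : ((π (y' - s • z) : N) : E →₀ R) ∈ q • N := by
          rw [← Finsupp.sum_single (y' - s • z), map_finsuppSum, Finsupp.sum,
            AddSubmonoidClass.coe_finsetSum]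
          refine Submodule.sum_mem _ fun e _ => ?_
          rw [← mul_one ((y' - s • z) e), ← Finsupp.smul_single', map_smul]
          exact Submodule.smul_mem_smul
            (Ideal.algebraMap_residueField_eq_zero.1 (DFunLike.congr_fun hyz e)) (π _).2
        have h2 := hπ ⟨y' - s • z, N.sub_mem (hQ hy') (N.smul_mem s hz)⟩
        rwa [h2] at h1
      obtain ⟨t, i, hi, hti⟩ := hq.exists_inv hs
      have : z = (t • y') + (i • z - t • (y' - s • z)) := by
        linear_combination (norm := module) -(hti • z)
      rw [this]
      exact Submodule.add_mem_sup (Q.smul_mem t hy')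
        (Submodule.sub_mem _ (Submodule.smul_mem_smul hi hz) (Submodule.smul_mem _ t hmem))
    obtain ⟨r, hr, hrN⟩ := Submodule.exists_sub_one_mem_and_smul_le_of_fg_of_le_sup
      (Module.Finite.iff_fg.1 ‹_›) le_rfl hN
    have hrq : r ∈ q := hle (hrN (Submodule.smul_mem_pointwise_smul y r N hy))
    exact hq.ne_top ((Ideal.eq_top_iff_one q).2 (by simpa using q.sub_mem hrq hr))
  have : (1 : R) ∈ Q.comap (LinearMap.toSpanSingleton R _ y) := htop ▸ Submodule.mem_top
  simpa using this

end Retraction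

theorem LinearMap.exists_retraction_ker_inf {R M M' : Type*} [CommRing R] [AddCommGroup M]
    [Module R M] [AddCommGroup M'] [Module R M'] (φ : M →ₗ[R] M') (F : Submodule R M)
    [Module.Projective R (F.map φ)] :
    ∃ ρ : F →ₗ[R] ↥(LinearMap.ker φ ⊓ F), ∀ y : ↥(LinearMap.ker φ ⊓ F), ρ ⟨y, y.2.2⟩ = y := by
  obtain ⟨σ, hσ⟩ := Module.projective_lifting_property (φ.submoduleMap F) .id
    (φ.submoduleMap_surjective F)
  have hσ' (y : F.map φ) : φ (σ y) = y := congrArg Subtype.val (LinearMap.congr_fun hσ y)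
  let ρ : F →ₗ[R] M := F.subtype - F.subtype ∘ₗ σ ∘ₗ φ.submoduleMap F
  refine ⟨ρ.codRestrict _ fun y => ⟨?_, F.sub_mem y.2 (Subtype.prop _)⟩, fun y => ?_⟩
  · change φ (y - σ (φ.submoduleMap F y)) = 0
    rw [map_sub, hσ']
    exact sub_self _
  · have : φ.submoduleMap F ⟨y, y.2.2⟩ = 0 := Subtype.ext y.2.1
    refine Subtype.ext ?_
    change (y : M) - σ (φ.submoduleMap F ⟨y, y.2.2⟩) = y
    rw [this, map_zero]
    exact sub_zero _

theorem IsSemihereditary.exists_retraction {R E E' : Type*} [CommRing R]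
    (hR : IsSemihereditary R) (φ : (E →₀ R) →ₗ[R] (E' →₀ R)) (T : Finset E) :
    ∃ π : (E →₀ R) →ₗ[R] ↥(LinearMap.ker φ ⊓ Finsupp.supported R R (T : Set E)),
      (∀ y : ↥(LinearMap.ker φ ⊓ Finsupp.supported R R (T : Set E)), π y = y) ∧
      Module.Finite R ↥(LinearMap.ker φ ⊓ Finsupp.supported R R (T : Set E)) := by
  classical
  have hF : Module.Finite R (Finsupp.supported R R (T : Set E)) :=
    Module.Finite.equiv (Finsupp.supportedEquivFinsupp _).symm
  have := hR.projective_of_fg _ ((Module.Finite.iff_fg.1 hF).map φ)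
  obtain ⟨ρ, hρ⟩ := φ.exists_retraction_ker_inf (Finsupp.supported R R (T : Set E))
  refine ⟨ρ ∘ₗ Finsupp.restrictDom R R (T : Set E), fun y => ?_,
    Module.Finite.of_surjective ρ fun y => ⟨_, hρ y⟩⟩
  have := LinearMap.congr_fun
    (Finsupp.restrictDom_comp_subtype (R := R) (M := R) (T : Set E)) ⟨y, y.2.2⟩
  rw [LinearMap.comp_apply]
  exact (congrArg ρ this).trans (hρ y)

theorem PrimeSpectrum.exists_minimalPrimes_le {R : Type*} [CommRing R] (q : PrimeSpectrum R) :
    ∃ p : PrimeSpectrum R, p.asIdeal ∈ minimalPrimes R ∧ p ≤ q := by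
  obtain ⟨p, hp, hpq⟩ := Ideal.exists_minimalPrimes_le (I := ⊥) (J := q.asIdeal) bot_le
  exact ⟨⟨p, hp.1.1⟩, hp, hpq⟩

section Stable

variable {R G E E' σ : Type*} [CommRing R] [AddCommMonoid G] [LinearOrder E] [LinearOrder E']
  [AddAction G E] [AddAction G E'] [Fintype σ] {x : σ → G} {E₀ : Finset E} {T₀ : Finset E'}

/-- A family of submodules supported on the levels and carried into itself by the translations. -/
structure IsStableFiltration (x : σ → G) (E₀ : Finset E) (P : ℕ → Submodule R (E →₀ R)) :
    Prop where
  le_supported (d : ℕ) : P d ≤ Finsupp.supported R R (level x E₀ d : Set E)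
  map_le (d : ℕ) (j : σ) : (P d).map (Finsupp.lmapDomain R R (x j +ᵥ ·)) ≤ P (d + 1)

theorem IsStableFiltration.isStableFamily {P : ℕ → Submodule R (E →₀ R)}
    (hP : IsStableFiltration x E₀ P) (hx : ∀ j, StrictMono (x j +ᵥ · : E → E)) (K : Type*)
    [Field K] [Algebra R K] :
    IsStableFamily x E₀ fun d => leadingExponents (fiberSpan K (P d)) where
  subset_level d := leadingExponents_subset (fiberSpan_le_supported (hP.le_supported d))
  vadd_mem d j e he := by
    refine leadingExponents_mono (fiberSpan_mono (hP.map_le d j)) ?_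
    rw [fiberSpan_map_lmapDomain]
    exact mem_leadingExponents_map (hx j) he

theorem isStableFiltration_supported (x : σ → G) (E₀ : Finset E) :
    IsStableFiltration x E₀ fun d => Finsupp.supported R R (level x E₀ d : Set E) where
  le_supported _ := le_rfl
  map_le d j := by
    rw [Finsupp.lmapDomain_supported]
    refine Finsupp.supported_mono ?_
    rintro _ ⟨e, he, rfl⟩
    exact vadd_mem_level j he

variable {φ : (E →₀ R) →ₗ[R] (E' →₀ R)}
  (hφ : ∀ j, φ ∘ₗ Finsupp.lmapDomain R R (x j +ᵥ ·) = Finsupp.lmapDomain R R (x j +ᵥ ·) ∘ₗ φ)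

include hφ

omit [LinearOrder E'] in
theorem IsStableFiltration.ker_inf {P : ℕ → Submodule R (E →₀ R)}
    (hP : IsStableFiltration x E₀ P) :
    IsStableFiltration x E₀ fun d => LinearMap.ker φ ⊓ P d where
  le_supported d := inf_le_right.trans (hP.le_supported d)
  map_le d j := by
    rintro _ ⟨y, hy, rfl⟩
    refine ⟨?_, hP.map_le d j ⟨y, hy.2, rfl⟩⟩
    have := LinearMap.congr_fun (hφ j) y
    rw [LinearMap.comp_apply, LinearMap.comp_apply, show φ y = 0 from hy.1, map_zero] at this
    exact this

theorem isStableFiltration_map_supported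
    (hT₀ : (Finsupp.supported R R (E₀ : Set E)).map φ ≤ Finsupp.supported R R (T₀ : Set E')) :
    IsStableFiltration x T₀ fun d => (Finsupp.supported R R (level x E₀ d : Set E)).map φ where
  le_supported d := by
    induction d with
    | zero => exact hT₀
    | succ d ih =>
      rw [Finsupp.supported_eq_span_single, Submodule.map_span, Submodule.span_le]
      rintro _ ⟨_, ⟨e, he, rfl⟩, rfl⟩
      obtain ⟨j, -, he⟩ := Finset.mem_biUnion.1 (Finset.mem_coe.1 he)
      obtain ⟨e', he', rfl⟩ := Finset.mem_image.1 he
      have := LinearMap.congr_fun (hφ j) (Finsupp.single e' 1)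
      rw [LinearMap.comp_apply, Finsupp.lmapDomain_apply, Finsupp.mapDomain_single] at this
      rw [this]
      refine (isStableFiltration_supported x T₀).map_le d j (Submodule.mem_map_of_mem (ih ?_))
      exact Submodule.mem_map_of_mem (Finsupp.single_mem_supported R 1 he')
  map_le d j := by
    rw [← Submodule.map_comp, ← hφ, Submodule.map_comp]
    exact Submodule.map_mono ((isStableFiltration_supported x E₀).map_le d j)

end Stable

namespace IsSemihereditary

variable {R G E E' σ : Type*} [CommRing R] (hR : IsSemihereditary R) [AddCommMonoid G]
  [LinearOrder E] [LinearOrder E'] [AddAction G E] [AddAction G E'] [Fintype σ] {x : σ → G}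
  {E₀ : Finset E} {T₀ : Finset E'} (hx : ∀ j, StrictMono (x j +ᵥ · : E → E))
  {p : PrimeSpectrum R} (hp : p.asIdeal ∈ minimalPrimes R)

include hR hx

include hp in
theorem eventually_forall_leadingExponents_subset {P : ℕ → Submodule R (E →₀ R)}
    (hP : IsStableFiltration x E₀ P) :
    ∀ᶠ q in 𝓝 p, ∀ d, leadingExponents (fiberSpan p.asIdeal.ResidueField (P d)) ⊆
      leadingExponents (fiberSpan q.asIdeal.ResidueField (P d)) := by
  obtain ⟨D, hD⟩ := (hP.isStableFamily hx p.asIdeal.ResidueField).exists_generatedFrom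
  have : ∀ᶠ q in 𝓝 p, ∀ d ∈ Finset.range (D + 1),
      leadingExponents (fiberSpan p.asIdeal.ResidueField (P d)) ⊆
        leadingExponents (fiberSpan q.asIdeal.ResidueField (P d)) := by
    rw [Filter.eventually_all_finset]
    exact fun d _ => hR.eventually_leadingExponents_subset hp (hP.le_supported d)
  filter_upwards [this] with q hq d
  rcases le_total d D with hd | hd
  · exact hq d (Finset.mem_range_succ_iff.2 hd)
  · induction d, hd using Nat.le_induction with
    | base => exact hq D (Finset.self_mem_range_succ D)
    | succ d hd ih =>
      intro e he
      obtain ⟨j, e', he', rfl⟩ := hD d hd e he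
      exact (hP.isStableFamily hx q.asIdeal.ResidueField).vadd_mem d j (ih he')

variable (hx' : ∀ j, StrictMono (x j +ᵥ · : E' → E')) {φ : (E →₀ R) →ₗ[R] (E' →₀ R)}
  (hφ : ∀ j, φ ∘ₗ Finsupp.lmapDomain R R (x j +ᵥ ·) = Finsupp.lmapDomain R R (x j +ᵥ ·) ∘ₗ φ)
  (hT₀ : (Finsupp.supported R R (E₀ : Set E)).map φ ≤ Finsupp.supported R R (T₀ : Set E'))

include hx' hφ hT₀

include hp in
theorem eventually_forall_ncard_eq :
    ∀ᶠ q in 𝓝 p, q.asIdeal ∈ minimalPrimes R → ∀ d,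
      (leadingExponents (fiberSpan q.asIdeal.ResidueField
        (LinearMap.ker φ ⊓ Finsupp.supported R R (level x E₀ d : Set E)))).ncard =
      (leadingExponents (fiberSpan p.asIdeal.ResidueField
        (LinearMap.ker φ ⊓ Finsupp.supported R R (level x E₀ d : Set E)))).ncard := by
  have hN := (isStableFiltration_supported (R := R) x E₀).ker_inf hφ
  have hF := isStableFiltration_map_supported hφ hT₀
  filter_upwards [hR.eventually_forall_leadingExponents_subset hx hp hN,
    hR.eventually_forall_leadingExponents_subset hx' hp hF] with q hqN hqF hq d
  have h1 := hR.ncard_leadingExponents_add hp φ _ _ (hF.le_supported d)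
  have h2 := hR.ncard_leadingExponents_add hq φ _ _ (hF.le_supported d)
  have h3 := Set.ncard_le_ncard (hqN d) ((level x E₀ d).finite_toSet.subset
    ((hN.isStableFamily hx q.asIdeal.ResidueField).subset_level d))
  have h4 := Set.ncard_le_ncard (hqF d) ((level x T₀ d).finite_toSet.subset
    ((hF.isStableFamily hx' q.asIdeal.ResidueField).subset_level d))
  omega

theorem exists_eventually_fiberSpan_le (q₀ : PrimeSpectrum R) :
    ∃ D, ∀ᶠ q in 𝓝 q₀, ∀ d, D ≤ d →
      fiberSpan q.asIdeal.ResidueField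
        (LinearMap.ker φ ⊓ Finsupp.supported R R (level x E₀ (d + 1) : Set E)) ≤
      fiberSpan q.asIdeal.ResidueField
        (⨆ j, (LinearMap.ker φ ⊓ Finsupp.supported R R (level x E₀ d : Set E)).map
          (Finsupp.lmapDomain R R (x j +ᵥ ·))) := by
  have hN := (isStableFiltration_supported (R := R) x E₀).ker_inf hφ
  obtain ⟨p, hp, hpq⟩ := q₀.exists_minimalPrimes_le
  obtain ⟨D, hD⟩ := exists_forall_generatedFrom x E₀ fun d =>
    (leadingExponents (fiberSpan p.asIdeal.ResidueField
        (LinearMap.ker φ ⊓ Finsupp.supported R R (level x E₀ d : Set E)))).ncard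
  refine ⟨D, ?_⟩
  filter_upwards [hR.eventually_forall_minimalPrimes (q₀ := q₀)
    (hR.eventually_forall_ncard_eq hx hp hx' hφ hT₀) hpq] with q hq d hd
  obtain ⟨p', hp', hpq'⟩ := q.exists_minimalPrimes_le
  have hgen := hD _ (hN.isStableFamily hx q.asIdeal.ResidueField) fun d => by
    rw [← hq p' hp' hpq' hp' d]
    obtain ⟨π, hπ, hfin⟩ := hR.exists_retraction φ (level x E₀ d)
    rw [ncard_leadingExponents (fiberSpan_le_supported (hN.le_supported d)),
      ncard_leadingExponents (fiberSpan_le_supported (hN.le_supported d)),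
      finrank_fiberSpan_eq_of_le π hπ (p := p') hpq']
  refine (eq_of_leadingExponents_subset (fiberSpan_mono (iSup_le (hN.map_le d)))
    (fiberSpan_le_supported (hN.le_supported (d + 1))) ?_).ge
  intro e he
  obtain ⟨j, e', he', rfl⟩ := hgen d hd e he
  refine leadingExponents_mono (fiberSpan_mono (le_iSup _ j)) ?_
  rw [fiberSpan_map_lmapDomain]
  exact mem_leadingExponents_map (hx j) he'

/-- The kernel of an equivariant map is eventually generated by translates of its elements of
bounded degree. -/
theorem exists_forall_ker_inf_le : ∃ D, ∀ d, D ≤ d →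
    LinearMap.ker φ ⊓ Finsupp.supported R R (level x E₀ (d + 1) : Set E) ≤
      ⨆ j, (LinearMap.ker φ ⊓ Finsupp.supported R R (level x E₀ d : Set E)).map
        (Finsupp.lmapDomain R R (x j +ᵥ ·)) := by
  have hN := (isStableFiltration_supported (R := R) x E₀).ker_inf hφ
  obtain ⟨D, hD⟩ : ∃ D, ∀ q ∈ (Set.univ : Set (PrimeSpectrum R)), ∀ d, D ≤ d →
      fiberSpan q.asIdeal.ResidueField
        (LinearMap.ker φ ⊓ Finsupp.supported R R (level x E₀ (d + 1) : Set E)) ≤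
      fiberSpan q.asIdeal.ResidueField
        (⨆ j, (LinearMap.ker φ ⊓ Finsupp.supported R R (level x E₀ d : Set E)).map
          (Finsupp.lmapDomain R R (x j +ᵥ ·))) := by
    refine isCompact_univ.induction_on ⟨0, fun q hq => hq.elim⟩ ?_ ?_ fun q₀ _ => ?_
    · rintro s t hst ⟨D, hD⟩
      exact ⟨D, fun q hq => hD q (hst hq)⟩
    · rintro s t ⟨D, hD⟩ ⟨D', hD'⟩
      exact ⟨max D D', fun q hq d hd => hq.elim (fun hq => hD q hq d (le_of_max_le_left hd))
        fun hq => hD' q hq d (le_of_max_le_right hd)⟩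
    · obtain ⟨D, hD⟩ := hR.exists_eventually_fiberSpan_le hx hx' hφ hT₀ q₀
      exact ⟨_, mem_nhdsWithin_of_mem_nhds hD, D, fun q hq => hq⟩
  refine ⟨D, fun d hd => ?_⟩
  obtain ⟨π, hπ, hfin⟩ := hR.exists_retraction φ (level x E₀ (d + 1))
  exact le_of_forall_fiberSpan_le π hπ (iSup_le (hN.map_le d)) fun q hq =>
    hD ⟨q, hq.isPrime⟩ trivial d hd

end IsSemihereditary

section Level

variable {G E σ : Type*} [AddCommMonoid G] [AddAction G E] [DecidableEq E] [Fintype σ] {x : σ → G}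
  {E₀ : Finset E}

theorem monotone_level (h0 : 0 ∈ Set.range x) : Monotone (level x E₀) := by
  obtain ⟨j, hj⟩ := h0
  refine monotone_nat_of_le_succ fun d e he => ?_
  simpa [hj] using vadd_mem_level j he

theorem exists_vadd_mem_level (hx : AddSubmonoid.closure (Set.range x) = ⊤) {e : E}
    (he : e ∈ E₀) (g : G) : ∃ d, g +ᵥ e ∈ level x E₀ d := by
  have hg : g ∈ AddSubmonoid.closure (Set.range x) := hx ▸ AddSubmonoid.mem_top g
  induction hg using AddSubmonoid.closure_induction_left with
  | zero => exact ⟨0, by simpa [level] using he⟩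
  | add_left _ h _ _ ih =>
    obtain ⟨j, rfl⟩ := h
    obtain ⟨d, hd⟩ := ih
    exact ⟨d + 1, by rw [add_vadd]; exact vadd_mem_level j hd⟩

end Level

/-- The action of `G` on `ι ×ₗ G` by translation of the second component. -/
abbrev AddAction.prodLexTranslation (ι G : Type*) [AddCommMonoid G] : AddAction G (ι ×ₗ G) where
  vadd g e := toLex ((ofLex e).1, g + (ofLex e).2)
  zero_vadd e := congrArg toLex (Prod.ext rfl (zero_add (ofLex e).2))
  add_vadd g g' e := congrArg toLex (Prod.ext rfl (add_assoc g g' (ofLex e).2))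

namespace IsSemihereditary

/-- The kernel of a linear map over an algebra `A`, between modules with `R`-coordinates which some
elements of `A` translate monotonically, is finitely generated. -/
theorem fg_ker_of_translations {R A G E E' σ M M' : Type*} [CommRing R] (hR : IsSemihereditary R)
    [AddCommMonoid G] [LinearOrder E] [LinearOrder E'] [AddAction G E] [AddAction G E'] [Fintype σ]
    [Ring A] [Algebra R A] [AddCommGroup M] [Module R M] [Module A M] [IsScalarTower R A M]
    [AddCommGroup M'] [Module R M'] [Module A M'] [IsScalarTower R A M'] {x : σ → G}
    (hx : ∀ j, StrictMono (x j +ᵥ · : E → E)) (hx' : ∀ j, StrictMono (x j +ᵥ · : E' → E'))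
    (hx0 : 0 ∈ Set.range x) {E₀ : Finset E} (hE₀ : ∀ e, ∃ d, e ∈ level x E₀ d)
    (θ : (E →₀ R) →ₗ[R] M) (hsurj : Function.Surjective θ) (c : M' ≃ₗ[R] (E' →₀ R)) (a : σ → A)
    (hθ : ∀ j y, θ (Finsupp.lmapDomain R R (x j +ᵥ ·) y) = a j • θ y)
    (hc : ∀ j m, c (a j • m) = Finsupp.lmapDomain R R (x j +ᵥ ·) (c m))
    (ψ : M →ₗ[A] M') : (LinearMap.ker ψ).FG := by
  classical
  let φ : (E →₀ R) →ₗ[R] (E' →₀ R) := c.toLinearMap ∘ₗ ψ.restrictScalars R ∘ₗ θ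
  have hφ0 (y : E →₀ R) : φ y = 0 ↔ ψ (θ y) = 0 := c.map_eq_zero_iff
  have hφ (j : σ) : φ ∘ₗ Finsupp.lmapDomain R R (x j +ᵥ ·) =
      Finsupp.lmapDomain R R (x j +ᵥ ·) ∘ₗ φ := by
    refine LinearMap.ext fun y => ?_
    change c (ψ (θ _)) = _
    rw [hθ, map_smul, hc]
    rfl
  let T₀ : Finset E' := E₀.biUnion fun e => (φ (Finsupp.single e 1)).support
  have hT₀ : (Finsupp.supported R R (E₀ : Set E)).map φ ≤
      Finsupp.supported R R (T₀ : Set E') := by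
    rw [Finsupp.supported_eq_span_single, Submodule.map_span, Submodule.span_le]
    rintro _ ⟨_, ⟨e, he, rfl⟩, rfl⟩
    exact Finset.coe_subset.2
      (Finset.subset_biUnion_of_mem (fun e => (φ (Finsupp.single e 1)).support) he)
  obtain ⟨D, hD⟩ := hR.exists_forall_ker_inf_le hx hx' hφ hT₀
  obtain ⟨-, -, hfin⟩ := hR.exists_retraction φ (level x E₀ D)
  generalize φ = φ at hφ0 hD hfin
  let N (d : ℕ) := LinearMap.ker φ ⊓ Finsupp.supported R R (level x E₀ d : Set E)
  let Q : Submodule A M := Submodule.span A (θ '' (N D : Set (E →₀ R)))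
  have hNQ (d : ℕ) (hd : D ≤ d) : (N d).map θ ≤ Q.restrictScalars R := by
    induction d, hd using Nat.le_induction with
    | base => exact Submodule.subset_span
    | succ d hd ih =>
      refine (Submodule.map_mono (hD d hd)).trans ?_
      rw [Submodule.map_iSup]
      refine iSup_le fun j => ?_
      rintro _ ⟨_, ⟨y, hy, rfl⟩, rfl⟩
      rw [hθ]
      exact Q.smul_mem _ (ih ⟨y, hy, rfl⟩)
  have hQ : LinearMap.ker ψ = Q := by
    refine le_antisymm (fun z hz => ?_) (Submodule.span_le.2 ?_)
    · obtain ⟨y, rfl⟩ := hsurj z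
      choose d hd using hE₀
      refine hNQ (max D (y.support.sup d)) (le_max_left _ _) ⟨y, ⟨(hφ0 y).2 hz, ?_⟩, rfl⟩
      exact fun e he => monotone_level hx0
        ((Finset.le_sup he).trans (le_max_right _ _)) (hd e)
    · rintro _ ⟨y, hy, rfl⟩
      exact (hφ0 y).1 hy.1
  obtain ⟨B, hB⟩ := Module.Finite.iff_fg.1 hfin
  rw [hQ]
  refine ⟨B.image θ, le_antisymm (Submodule.span_mono ?_) (Submodule.span_le.2 ?_)⟩
  · rw [Finset.coe_image]
    refine Set.image_mono ?_
    change _ ⊆ ((LinearMap.ker φ ⊓ Finsupp.supported R R (level x E₀ D : Set E) :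
      Submodule R (E →₀ R)) : Set (E →₀ R))
    exact hB ▸ Submodule.subset_span
  · rintro _ ⟨y, hy, rfl⟩
    change y ∈ LinearMap.ker φ ⊓ Finsupp.supported R R (level x E₀ D : Set E) at hy
    rw [← hB] at hy
    have := Submodule.mem_map_of_mem (f := θ) hy
    rw [Submodule.map_span] at this
    rw [Finset.coe_image]
    exact Submodule.span_le_restrictScalars R A _ this

variable {R G : Type*} [CommRing R] (hR : IsSemihereditary R) [AddCommMonoid G] [LinearOrder G]
  [IsOrderedCancelAddMonoid G] [hG : AddMonoid.FG G]

open AddMonoidAlgebra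

include hR hG

theorem fg_ker_linearCombination {k : ℕ} (f : Fin k → AddMonoidAlgebra R G) :
    (LinearMap.ker (Fintype.linearCombination (AddMonoidAlgebra R G) f)).FG := by
  classical
  obtain ⟨S, hS⟩ := AddMonoid.fg_def.1 hG
  let x : ↥(insert 0 S) → G := Subtype.val
  have hrange : Set.range x = insert 0 (S : Set G) := by
    rw [Subtype.range_coe, Finset.coe_insert]
  have hx0 : 0 ∈ Set.range x := hrange ▸ Set.mem_insert _ _
  have hx : AddSubmonoid.closure (Set.range x) = ⊤ := by
    rw [eq_top_iff, ← hS, hrange]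
    exact AddSubmonoid.closure_mono (Set.subset_insert _ _)
  let instAct : AddAction G (Fin k ×ₗ G) := AddAction.prodLexTranslation (Fin k) G
  have hv (g : G) (e : Fin k ×ₗ G) : g +ᵥ e = toLex ((ofLex e).1, g + (ofLex e).2) := rfl
  refine hR.fg_ker_of_translations (x := x) (E := Fin k ×ₗ G) (E' := G)
    (E₀ := Finset.univ.image fun i => toLex (i, 0)) (fun j e e' h => ?_)
    (fun j => add_right_strictMono) hx0 (fun e => ?_)
    (Finsupp.linearCombination R fun e => Pi.single (ofLex e).1 (single (ofLex e).2 1)) ?_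
    (coeffLinearEquiv R) (fun j => single (x j) 1) (fun j y => ?_) (fun j m => ?_) _
  · rw [Prod.Lex.lt_iff] at h ⊢
    simpa [hv] using h
  · have := exists_vadd_mem_level hx (Finset.mem_image_of_mem (fun i : Fin k => toLex (i, (0 : G)))
      (Finset.mem_univ (ofLex e).1)) (ofLex e).2
    simpa [hv] using this
  · rw [← LinearMap.range_eq_top, eq_top_iff]
    rintro m -
    rw [← Finset.univ_sum_single m]
    refine Submodule.sum_mem _ fun i _ => ?_
    induction m i using AddMonoidAlgebra.induction_linear with
    | zero => simp
    | add a b ha hb => rw [Pi.single_add]; exact Submodule.add_mem _ ha hb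
    | single g r => exact ⟨Finsupp.single (toLex (i, g)) r, by simp [← Pi.single_smul]⟩
  · induction y using Finsupp.induction_linear with
    | zero => simp
    | add y z hy hz => rw [map_add, map_add, hy, hz, map_add, smul_add]
    | single e r =>
      simp [Finsupp.mapDomain_single, hv, ← Pi.single_smul, single_mul_single]
  · induction m using AddMonoidAlgebra.induction_linear with
    | zero => simp
    | add a b ha hb => rw [smul_add, map_add, ha, hb, map_add, map_add]
    | single g r => simp [Finsupp.mapDomain_single, single_mul_single]

theorem finitePresentation_ideal (I : Ideal (AddMonoidAlgebra R G)) (hI : I.FG) :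
    Module.FinitePresentation (AddMonoidAlgebra R G) I := by
  obtain ⟨k, f, hf⟩ := Submodule.fg_iff_exists_fin_generating_family.1 hI
  have hrange : LinearMap.range (Fintype.linearCombination (AddMonoidAlgebra R G) f) = I := by
    rw [Fintype.range_linearCombination, hf]
  subst hrange
  refine Module.finitePresentation_of_surjective _
    (LinearMap.surjective_rangeRestrict (Fintype.linearCombination (AddMonoidAlgebra R G) f)) ?_
  rw [LinearMap.ker_rangeRestrict]
  exact hR.fg_ker_linearCombination f

end IsSemihereditary

theorem IsSemihereditary.finitePresentation_laurent {R : Type*} [CommRing R]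
    (hR : IsSemihereditary R) (n : ℕ) (I : Ideal (AddMonoidAlgebra R (Fin n →₀ ℤ))) (hI : I.FG) :
    Module.FinitePresentation (AddMonoidAlgebra R (Fin n →₀ ℤ)) I := by
  have : AddMonoid.FG (Fin n →₀ ℤ) :=
    AddGroup.fg_iff_addMonoid_fg.1 (Module.Finite.iff_addGroup_fg.1 inferInstance)
  exact @finitePresentation_ideal R (Fin n →₀ ℤ) _ hR _
    (inferInstanceAs (LinearOrder (Lex (Fin n →₀ ℤ))))
    (inferInstanceAs (IsOrderedCancelAddMonoid (Lex (Fin n →₀ ℤ)))) this I hI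

section ProjectiveDimension

open CategoryTheory

universe u

variable {R : Type u} [CommRing R] {M₁ M₂ M₃ : Type u} [AddCommGroup M₁] [AddCommGroup M₂]
  [AddCommGroup M₃] [Module R M₁] [Module R M₂] [Module R M₃]

theorem shortExact_moduleCatMk {f : M₁ →ₗ[R] M₂} {g : M₂ →ₗ[R] M₃} (hf : Function.Injective f)
    (hg : Function.Surjective g) (h : Function.Exact f g) :
    (ShortComplex.moduleCatMk f g h.linearMap_comp_eq_zero).ShortExact where
  exact := (ShortComplex.ShortExact.moduleCat_exact_iff_function_exact _).2 h
  mono_f := (ModuleCat.mono_iff_injective _).2 hf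
  epi_g := (ModuleCat.epi_iff_surjective _).2 hg

/-- The `R`-module `M` has projective dimension at most `d`. -/
abbrev Module.PdLE (R : Type u) [CommRing R] (M : Type u) [AddCommGroup M] [Module R M] (d : ℕ) :
    Prop :=
  HasProjectiveDimensionLE (ModuleCat.of R M) d

namespace Module.PdLE

theorem zero_iff : PdLE R M₁ 0 ↔ Module.Projective R M₁ := by
  rw [PdLE, ← projective_iff_hasProjectiveDimensionLE_zero, ← IsProjective.iff_projective]

theorem mono {d e : ℕ} (hd : PdLE R M₁ d) (h : d ≤ e) : PdLE R M₁ e :=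
  have : HasProjectiveDimensionLT (ModuleCat.of R M₁) (d + 1) := hd
  hasProjectiveDimensionLT_of_ge _ (d + 1) (e + 1) (by lia)

theorem of_exact {f : M₁ →ₗ[R] M₂} {g : M₂ →ₗ[R] M₃} (hf : Function.Injective f)
    (hg : Function.Surjective g) (h : Function.Exact f g) {d : ℕ} (h₁ : PdLE R M₁ d)
    (h₂ : PdLE R M₂ d) : PdLE R M₃ (d + 1) :=
  (shortExact_moduleCatMk hf hg h).hasProjectiveDimensionLT_X₃ (d + 1) h₁
    (h₂.mono d.le_succ)

theorem left_of_exact {f : M₁ →ₗ[R] M₂} {g : M₂ →ₗ[R] M₃} (hf : Function.Injective f)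
    (hg : Function.Surjective g) (h : Function.Exact f g) {d : ℕ} [Module.Projective R M₂]
    (h₃ : PdLE R M₃ (d + 1)) : PdLE R M₁ d :=
  (shortExact_moduleCatMk hf hg h).hasProjectiveDimensionLT_X₁ (d + 1)
    ((zero_iff.2 ‹_›).mono d.zero_le) h₃

theorem ker {g : M₂ →ₗ[R] M₃} (hg : Function.Surjective g) {d : ℕ} [Module.Projective R M₂]
    (h₃ : PdLE R M₃ (d + 1)) : PdLE R (LinearMap.ker g) d :=
  left_of_exact (LinearMap.ker g).injective_subtype hg g.exact_subtype_ker_map h₃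

theorem hasFPD {d : ℕ} (h : PdLE R M₁ d) : HasFPD R d (ModuleCat.of R M₁) := by
  induction d generalizing M₁ with
  | zero => exact zero_iff.1 h
  | succ d ih =>
    exact ⟨ModuleCat.of R (M₁ →₀ R), Finsupp.linearCombination R id,
      inferInstanceAs (Module.Projective R (M₁ →₀ R)),
      Finsupp.linearCombination_id_surjective R M₁,
      ih (h.ker (Finsupp.linearCombination_id_surjective R M₁))⟩

open TensorProduct in
theorem baseChange (A : Type u) [CommRing A] [Algebra R A] [Module.Flat R A] {d : ℕ}
    (h : PdLE R M₁ d) : PdLE A (A ⊗[R] M₁) d := by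
  induction d generalizing M₁ with
  | zero =>
    have := zero_iff.1 h
    exact zero_iff.2 inferInstance
  | succ d ih =>
    have aux {F : Type u} [AddCommGroup F] [Module R F] [Module.Projective R F] (g : F →ₗ[R] M₁)
        (hg : Function.Surjective g) : PdLE A (A ⊗[R] M₁) (d + 1) := by
      refine of_exact (f := (LinearMap.ker g).subtype.baseChange A) (g := g.baseChange A) ?_ ?_ ?_
        (ih (h.ker hg)) ((zero_iff.2 inferInstance).mono d.zero_le)
      · exact Module.Flat.lTensor_preserves_injective_linearMap _
          (LinearMap.ker g).injective_subtype
      · exact LinearMap.lTensor_surjective _ hg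
      · exact lTensor_exact A g.exact_subtype_ker_map hg
    exact aux _ (Finsupp.linearCombination_id_surjective R M₁)

end Module.PdLE

end ProjectiveDimension

section LaurentProjectiveDimension

open TensorProduct LaurentPolynomial

universe u

namespace LaurentPolynomial

variable {B : Type u} [CommRing B] (M : Type u) [AddCommGroup M] [Module B M] [Module B[T;T⁻¹] M]
  [IsScalarTower B B[T;T⁻¹] M]

/-- The endomorphism `a ⊗ m ↦ T a ⊗ m - a ⊗ T m`, whose cokernel is `M`. -/
noncomputable def tensorShift : B[T;T⁻¹] ⊗[B] M →ₗ[B[T;T⁻¹]] B[T;T⁻¹] ⊗[B] M :=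
  (T 1 : B[T;T⁻¹]) • LinearMap.id - (Algebra.lsmul B B M (T 1 : B[T;T⁻¹])).baseChange B[T;T⁻¹]

/-- The action of the Laurent polynomial ring as a map from the tensor product. -/
noncomputable def tensorAction : B[T;T⁻¹] ⊗[B] M →ₗ[B[T;T⁻¹]] M :=
  (LinearMap.id : M →ₗ[B] M).liftBaseChange B[T;T⁻¹]

variable {M}

theorem tensorShift_tmul (a : B[T;T⁻¹]) (m : M) :
    tensorShift M (a ⊗ₜ[B] m) = (T 1 * a) ⊗ₜ[B] m - a ⊗ₜ[B] ((T 1 : B[T;T⁻¹]) • m) := by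
  simp [tensorShift, smul_tmul']

theorem tensorAction_tmul (a : B[T;T⁻¹]) (m : M) : tensorAction M (a ⊗ₜ[B] m) = a • m := by
  simp [tensorAction]

theorem tensorAction_surjective : Function.Surjective (tensorAction (B := B) M) := fun m =>
  ⟨1 ⊗ₜ[B] m, by simp [tensorAction_tmul]⟩

theorem tensorShift_coord (x : B[T;T⁻¹] ⊗[B] M) (i : ℤ) :
    equivFinsuppOfBasisLeft (AddMonoidAlgebra.basis ℤ B) (tensorShift M x) (i + 1) =
      equivFinsuppOfBasisLeft (AddMonoidAlgebra.basis ℤ B) x i -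
        (T 1 : B[T;T⁻¹]) • equivFinsuppOfBasisLeft (AddMonoidAlgebra.basis ℤ B) x (i + 1) := by
  induction x with
  | zero => simp
  | add x y hx hy => simp only [map_add, Finsupp.add_apply, hx, hy, smul_add]; abel
  | tmul a m =>
    rw [tensorShift_tmul, map_sub, Finsupp.sub_apply]
    simp only [equivFinsuppOfBasisLeft_apply_tmul_apply]
    have h : ((AddMonoidAlgebra.basis ℤ B).repr (T 1 * a)) (i + 1) =
        (AddMonoidAlgebra.basis ℤ B).repr a i := by
      change (AddMonoidAlgebra.single 1 1 * a : B[T;T⁻¹]).coeff (i + 1) = a.coeff i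
      rw [add_comm, AddMonoidAlgebra.coeff_single_mul_add, one_mul]
    rw [h, smul_comm]

theorem tensorShift_injective : Function.Injective (tensorShift (B := B) M) := by
  rw [injective_iff_map_eq_zero]
  intro x hx
  set c := equivFinsuppOfBasisLeft (N := M) (AddMonoidAlgebra.basis ℤ B) with hc
  by_contra hne
  have hne : (c x).support.Nonempty := by
    rw [Finsupp.support_nonempty_iff]
    exact fun h => hne (c.map_eq_zero_iff.1 h)
  obtain ⟨i, hi, hmin⟩ := (c x).support.exists_minimal hne
  have h := tensorShift_coord x (i - 1)
  rw [hx, sub_add_cancel, map_zero, Finsupp.zero_apply, ← hc] at h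
  have hlt : c x (i - 1) = 0 := by
    by_contra h'
    have := hmin (Finsupp.mem_support_iff.2 h') (by simp)
    lia
  rw [hlt, zero_sub, eq_comm, neg_eq_zero, (isUnit_T 1).smul_eq_zero] at h
  exact Finsupp.mem_support_iff.1 hi h

theorem tmul_sub_one_tmul_smul_mem (a : B[T;T⁻¹]) (m : M) :
    a ⊗ₜ[B] m - 1 ⊗ₜ[B] (a • m) ∈ LinearMap.range (tensorShift (B := B) M) := by
  have hT (i : ℤ) (m : M) : T i ⊗ₜ[B] m - 1 ⊗ₜ[B] ((T i : B[T;T⁻¹]) • m) ∈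
      LinearMap.range (tensorShift (B := B) M) := by
    induction i generalizing m with
    | zero => simp
    | succ i ih =>
      have := add_mem (ih ((T 1 : B[T;T⁻¹]) • m)) ⟨T i ⊗ₜ m, rfl⟩
      rw [tensorShift_tmul, ← T_add, smul_smul, ← T_add, add_comm 1] at this
      convert this using 1
      abel
    | pred i ih =>
      have := sub_mem (ih ((T (-1) : B[T;T⁻¹]) • m)) ⟨T (-i - 1) ⊗ₜ ((T (-1) : B[T;T⁻¹]) • m), rfl⟩
      rw [tensorShift_tmul, ← T_add, smul_smul, smul_smul, ← T_add, ← T_add] at this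
      convert this using 1
      simp only [add_neg_cancel, T_zero, one_smul, sub_eq_add_neg,
        add_neg_cancel_comm_assoc]
      abel
  induction a using LaurentPolynomial.induction_on' with
  | add p q hp hq =>
    convert add_mem hp hq using 1
    rw [add_tmul, add_smul, tmul_add]
    abel
  | C_mul_T i b =>
    convert Submodule.smul_mem _ (C b) (hT i m) using 1
    rw [smul_sub, smul_tmul', smul_tmul', smul_eq_mul, smul_eq_mul, mul_one, mul_smul]
    congr 1
    rw [show C b = b • (1 : B[T;T⁻¹]) by rw [smul_eq_C_mul, mul_one], smul_assoc, one_smul,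
      tmul_smul, smul_tmul']

theorem exact_tensorShift_tensorAction :
    Function.Exact (tensorShift (B := B) M) (tensorAction M) := by
  have key (x : B[T;T⁻¹] ⊗[B] M) : x - 1 ⊗ₜ[B] tensorAction M x ∈
      LinearMap.range (tensorShift (B := B) M) := by
    induction x with
    | zero => simp
    | add x y hx hy =>
      convert add_mem hx hy using 1
      rw [map_add, tmul_add]
      abel
    | tmul a m => simpa only [tensorAction_tmul] using tmul_sub_one_tmul_smul_mem a m
  refine fun x => ⟨fun hx => by simpa [hx] using key x, ?_⟩
  rintro ⟨y, rfl⟩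
  induction y with
  | zero => simp
  | add x y hx hy => rw [map_add, map_add, hx, hy, add_zero]
  | tmul a m =>
    rw [tensorShift_tmul, map_sub, tensorAction_tmul, tensorAction_tmul, smul_smul, mul_comm,
      sub_self]

theorem pdLE {d : ℕ} (h : Module.PdLE B M d) : Module.PdLE B[T;T⁻¹] M (d + 1) :=
  .of_exact tensorShift_injective tensorAction_surjective exact_tensorShift_tensorAction
    (h.baseChange _) (h.baseChange _)

end LaurentPolynomial

end LaurentProjectiveDimension

namespace Module.PdLE

universe u

/-- The projective dimension of an increasing union of projective submodules is at most one. -/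
theorem one_of_monotone {R : Type u} [CommRing R] {M : Type u} [AddCommGroup M] [Module R M]
    (P : ℕ →o Submodule R M) (hP : ∀ d, Module.Projective R (P d)) (htop : ⨆ d, P d = ⊤) :
    PdLE R M 1 := by
  classical
  let s : (Π₀ d, P d) →ₗ[R] Π₀ d, P d := DFinsupp.lsum ℕ fun d =>
    DFinsupp.lsingle (M := fun d => P d) d -
      DFinsupp.lsingle (M := fun d => P d) (d + 1) ∘ₗ Submodule.inclusion (P.mono d.le_succ)
  let p : (Π₀ d, P d) →ₗ[R] M := DFinsupp.lsum ℕ fun d => (P d).subtype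
  have hs (d : ℕ) (x : P d) : s (DFinsupp.single d x) = DFinsupp.single d x -
      DFinsupp.single (d + 1) (Submodule.inclusion (P.mono d.le_succ) x) := by
    simp [s]
  have hp (d : ℕ) (x : P d) : p (DFinsupp.single d x) = x := by simp [p]
  have hs_zero (x : Π₀ d, P d) : s x 0 = x 0 := by
    induction x using DFinsupp.induction with
    | h0 => simp
    | ha d y f _ _ hf =>
      rw [map_add, DFinsupp.add_apply, DFinsupp.add_apply, hf, hs]
      simp
  have hs_succ (x : Π₀ d, P d) (d : ℕ) : (s x (d + 1) : M) = x (d + 1) - x d := by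
    induction x using DFinsupp.induction with
    | h0 => simp
    | ha e y f _ _ hf =>
      simp only [map_add s, DFinsupp.add_apply, Submodule.coe_add, hf, hs, DFinsupp.sub_apply,
        Submodule.coe_sub]
      rw [add_sub_add_comm]
      congr 2
      by_cases h : e = d
      · subst h; simp
      · rw [DFinsupp.single_eq_of_ne (i' := d) (by lia),
          DFinsupp.single_eq_of_ne (i := e + 1) (i' := d + 1) (by lia)]
        rfl
  have hclose {d e : ℕ} (hde : d ≤ e) (x : P d) :
      DFinsupp.single d x - DFinsupp.single e (Submodule.inclusion (P.mono hde) x) ∈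
        LinearMap.range s := by
    induction e, hde using Nat.le_induction with
    | base => exact ⟨0, by rw [map_zero]; exact (sub_self _).symm⟩
    | succ e hde ih =>
      have := add_mem ih ⟨DFinsupp.single e (Submodule.inclusion (P.mono hde) x), hs _ _⟩
      rwa [sub_add_sub_cancel] at this
  have hlevel (x : Π₀ d, P d) :
      ∃ (d : ℕ) (y : P d), x - DFinsupp.single d y ∈ LinearMap.range s := by
    induction x using DFinsupp.induction with
    | h0 => exact ⟨0, 0, by simp⟩
    | ha e y f _ _ hf =>
      obtain ⟨d, z, hz⟩ := hf
      refine ⟨e + d, Submodule.inclusion (P.mono (e.le_add_right d)) y +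
        Submodule.inclusion (P.mono (d.le_add_left e)) z, ?_⟩
      convert add_mem (hclose (e.le_add_right d) y) (add_mem hz (hclose (d.le_add_left e) z))
        using 1
      rw [DFinsupp.single_add]
      abel
  have hps : p ∘ₗ s = 0 := by
    ext d x
    simp [hs, hp]
  refine of_exact (f := s) (g := p) ?_ ?_ ?_ (zero_iff.2 inferInstance) (zero_iff.2 inferInstance)
  · rw [injective_iff_map_eq_zero]
    intro x hx
    ext1 d
    induction d with
    | zero => rw [← hs_zero, hx]
    | succ d ih =>
      have := hs_succ x d
      rw [hx, ih] at this
      exact Subtype.ext (by simpa using this.symm)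
  · intro m
    obtain ⟨d, hd⟩ := (Submodule.mem_iSup_of_directed _ P.mono.directed_le).1
      (htop.ge (Submodule.mem_top (x := m)))
    exact ⟨DFinsupp.single d ⟨m, hd⟩, hp _ _⟩
  · refine fun x => ⟨fun hx => ?_, ?_⟩
    · obtain ⟨d, y, z, hz⟩ := hlevel x
      have := LinearMap.congr_fun hps z
      rw [LinearMap.comp_apply, hz, map_sub, hx, hp, zero_sub, LinearMap.zero_apply,
        neg_eq_zero, ZeroMemClass.coe_eq_zero] at this
      exact ⟨z, by rw [hz, this, DFinsupp.single_zero, sub_zero]⟩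
    · rintro ⟨y, rfl⟩
      exact LinearMap.congr_fun hps y

end Module.PdLE

universe u

theorem IsSemihereditary.pdLE_one {R : Type u} [CommRing R] (hR : IsSemihereditary R) {M : Type u}
    [AddCommGroup M] [Module R M] {E : Type*} {φ : M →ₗ[R] E →₀ R} (hφ : Function.Injective φ)
    {s : Set M} (hs : s.Countable) (hspan : Submodule.span R s = ⊤) : Module.PdLE R M 1 := by
  obtain ⟨f, hf⟩ := (hs.insert 0).exists_eq_range (Set.insert_nonempty 0 s)
  refine Module.PdLE.one_of_monotone
    ⟨fun d => Submodule.span R (f '' Set.Iio d), fun d e h =>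
      Submodule.span_mono (Set.image_mono (Set.Iio_subset_Iio h))⟩ (fun d => ?_) ?_
  · have hfg : (Submodule.span R (f '' Set.Iio d)).FG :=
      Submodule.fg_span ((Set.finite_Iio d).image f)
    have := hR.projective_of_fg _ (hfg.map φ)
    exact Module.Projective.of_equiv (Submodule.equivMapOfInjective φ hφ _).symm
  · rw [eq_top_iff, ← hspan, Submodule.span_le]
    intro x hx
    obtain ⟨d, rfl⟩ := hf.le (Set.mem_insert_of_mem 0 hx)
    exact Submodule.mem_iSup_of_mem (d + 1) (Submodule.subset_span ⟨d, Nat.lt_succ_self d, rfl⟩)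

theorem IsSemihereditary.pdLE_one_ideal {R : Type u} {G : Type} [CommRing R] [AddCommMonoid G]
    [Countable G] (hR : IsSemihereditary R) (I : Ideal (AddMonoidAlgebra R G)) (hI : I.FG) :
    Module.PdLE R I 1 := by
  obtain ⟨t, ht⟩ := (Module.Finite.iff_fg.2 hI).fg_top
  have hA := (AddMonoidAlgebra.basis G R).span_eq
  refine hR.pdLE_one (φ := (AddMonoidAlgebra.coeffLinearEquiv R).toLinearMap ∘ₗ
    I.subtype.restrictScalars R)
    ((AddMonoidAlgebra.coeffLinearEquiv R).injective.comp I.injective_subtype)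
    ((Set.countable_range _).image2 t.countable_toSet _)
    ((Submodule.span_smul_of_span_eq_top hA (t : Set I)).trans ?_)
  rw [ht, Submodule.restrictScalars_top]

section

open LaurentPolynomial

/-- Splitting off the first variable of a Laurent polynomial ring. -/
noncomputable def laurentSuccEquiv (R : Type*) [CommRing R] (n : ℕ) :
    AddMonoidAlgebra R (Fin (n + 1) →₀ ℤ) ≃ₐ[R] (AddMonoidAlgebra R (Fin n →₀ ℤ))[T;T⁻¹] :=
  (AddMonoidAlgebra.domCongr R R ((Finsupp.linearEquivFunOnFinite ℤ ℤ (Fin (n + 1))).trans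
    ((Fin.consLinearEquiv ℤ fun _ : Fin (n + 1) => ℤ).symm.trans
      ((LinearEquiv.refl ℤ ℤ).prodCongr
        (Finsupp.linearEquivFunOnFinite ℤ ℤ (Fin n)).symm))).toAddEquiv).trans
    (AddMonoidAlgebra.curryAlgEquiv R)

attribute [local instance] RingHomInvPair.of_ringEquiv in
theorem Module.PdLE.of_ringEquiv {R S M : Type u} [CommRing R] [CommRing S] [AddCommGroup M]
    [Module R M] [Module S M] (e : R ≃+* S) (he : ∀ (r : R) (m : M), e r • m = r • m) {d : ℕ}
    (h : Module.PdLE R M d) : Module.PdLE S M d := by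
  let e' : ModuleCat.of R M ≃ₛₗ[RingHomClass.toRingHom e] ModuleCat.of S M :=
    { AddEquiv.refl M with map_smul' := fun r m => (he r m).symm }
  have : CategoryTheory.HasProjectiveDimensionLE (ModuleCat.of R M) d := h
  exact ModuleCat.hasProjectiveDimensionLE_of_semiLinearEquiv e e' d

theorem Module.PdLE.laurent {R : Type u} [CommRing R] (n : ℕ) {M : Type u} [AddCommGroup M]
    [Module R M] {d : ℕ} (h : Module.PdLE R M d) : ∀ [Module (AddMonoidAlgebra R (Fin n →₀ ℤ)) M]
    [IsScalarTower R (AddMonoidAlgebra R (Fin n →₀ ℤ)) M],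
    Module.PdLE (AddMonoidAlgebra R (Fin n →₀ ℤ)) M (d + n) := by
  induction n with
  | zero =>
    intro _ _
    refine h.of_ringEquiv (AddMonoidAlgebra.uniqueRingEquiv (R := R) (Fin 0 →₀ ℤ)).symm
      fun r m => ?_
    rw [AddMonoidAlgebra.uniqueRingEquiv_symm_apply]
    exact algebraMap_smul (AddMonoidAlgebra R (Fin 0 →₀ ℤ)) r m
  | succ n ih =>
    intro _ _
    let e := laurentSuccEquiv R n
    let _ : Module (AddMonoidAlgebra R (Fin n →₀ ℤ))[T;T⁻¹] M :=
      Module.compHom M e.symm.toRingEquiv.toRingHom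
    let _ : Module (AddMonoidAlgebra R (Fin n →₀ ℤ)) M :=
      Module.compHom M (algebraMap _ (AddMonoidAlgebra R (Fin n →₀ ℤ))[T;T⁻¹])
    have : IsScalarTower (AddMonoidAlgebra R (Fin n →₀ ℤ))
      (AddMonoidAlgebra R (Fin n →₀ ℤ))[T;T⁻¹] M := .of_algebraMap_smul fun _ _ => rfl
    have : IsScalarTower R (AddMonoidAlgebra R (Fin n →₀ ℤ)) M := .of_algebraMap_smul fun r m => by
      change e.symm (algebraMap (AddMonoidAlgebra R (Fin n →₀ ℤ)) _ (algebraMap R _ r)) • m = _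
      rw [← IsScalarTower.algebraMap_apply R (AddMonoidAlgebra R (Fin n →₀ ℤ))
        (AddMonoidAlgebra R (Fin n →₀ ℤ))[T;T⁻¹], AlgEquiv.commutes, algebraMap_smul]
    exact (LaurentPolynomial.pdLE ih).of_ringEquiv e.symm.toRingEquiv fun _ _ => rfl

end

/-- If `R` is a semihereditary commutative ring, then the Laurent polynomial ring
`R[t₁,t₁⁻¹,…,tₙ,tₙ⁻¹]` is coherent and regular: every finitely generated ideal is finitely
presented and has finite projective dimension. -/
theorem laurent_coherent_regular_of_semihereditary
    (R : Type u) [CommRing R] (hR : IsSemihereditary R) (n : ℕ) :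
    (∀ I : Ideal (AddMonoidAlgebra R (Fin n →₀ ℤ)), I.FG →
      Module.FinitePresentation (AddMonoidAlgebra R (Fin n →₀ ℤ)) I) ∧
    (∀ I : Ideal (AddMonoidAlgebra R (Fin n →₀ ℤ)), I.FG →
      ∃ d : ℕ, HasFPD (AddMonoidAlgebra R (Fin n →₀ ℤ)) d
        (ModuleCat.of (AddMonoidAlgebra R (Fin n →₀ ℤ)) I)) := by
  refine ⟨hR.finitePresentation_laurent n, fun I hI => ?_⟩
  exact ⟨1 + n, ((hR.pdLE_one_ideal I hI).laurent n).hasFPD⟩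
end

section
/- Let R be a commutative Noetherian regular ring, and for i = 1,...,r let A^i = R[t_{i1}, t_{i2}]/(t_{i1}t_{i2}); set A = A¹ ⊗_R ⋯ ⊗_R A^r. Then the natural map K₀(R) → K₀(A) induced by base extension is surjective. -/
universe u

/-- A finitely generated projective module. -/
def IsFGProj (R : Type u) [CommRing R] (M : ModuleCat.{u} R) : Prop :=
  Module.Finite R M ∧ Module.Projective R M

/-- Isomorphism-class generators for `K₀`. -/
def FGProjCl (R : Type u) [CommRing R] := {M : ModuleCat.{u} R // IsFGProj R M}

/-- Relations `[M ⊕ N] = [M] + [N]` defining `K₀(R)`. -/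
def K0Rels (R : Type u) [CommRing R] : AddSubgroup (FreeAbelianGroup (FGProjCl R)) :=
  AddSubgroup.closure {x | ∃ M N P : FGProjCl R,
    Nonempty ((P.1 : Type u) ≃ₗ[R] ((M.1 : Type u) × (N.1 : Type u))) ∧
    x = FreeAbelianGroup.of P - FreeAbelianGroup.of M - FreeAbelianGroup.of N}

/-- The Grothendieck group `K₀(R)` of finitely generated projective `R`-modules. -/
abbrev K0 (R : Type u) [CommRing R] := FreeAbelianGroup (FGProjCl R) ⧸ K0Rels R

/-- The class of a finitely generated projective module in `K₀(R)`. -/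
def K0.cls (R : Type u) [CommRing R] (M : FGProjCl R) : K0 R :=
  QuotientAddGroup.mk (FreeAbelianGroup.of M)

/-- The local rank of a module at a prime. -/
noncomputable def rankAt (R : Type u) [CommRing R] (p : PrimeSpectrum R) (M : Type u)
    [AddCommGroup M] [Module R M] : ℕ :=
  Module.finrank (Localization.AtPrime p.asIdeal) (LocalizedModule p.asIdeal.primeCompl M)

/-- An invertible module: finitely generated projective of constant rank one. -/
def IsInvMod (R : Type u) [CommRing R] (M : ModuleCat.{u} R) : Prop :=
  IsFGProj R M ∧ ∀ p : PrimeSpectrum R, rankAt R p M = 1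

/-- Isomorphism-class generators for the Picard group. -/
def InvCl (R : Type u) [CommRing R] := {M : ModuleCat.{u} R // IsInvMod R M}

/-- Relations `[M ⊗ N] = [M] + [N]` defining `Pic(R)`. -/
def PicRels (R : Type u) [CommRing R] : AddSubgroup (FreeAbelianGroup (InvCl R)) :=
  AddSubgroup.closure {x | ∃ M N P : InvCl R,
    Nonempty ((P.1 : Type u) ≃ₗ[R] (TensorProduct R (M.1 : Type u) (N.1 : Type u))) ∧
    x = FreeAbelianGroup.of P - FreeAbelianGroup.of M - FreeAbelianGroup.of N}

/-- The Picard group of `R`. -/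
abbrev PicG (R : Type u) [CommRing R] := FreeAbelianGroup (InvCl R) ⧸ PicRels R

/-- The class of an invertible module in `Pic(R)`. -/
def PicG.cls (R : Type u) [CommRing R] (M : InvCl R) : PicG R :=
  QuotientAddGroup.mk (FreeAbelianGroup.of M)

/-- The `r`-fold tensor product over `R` of the rings `R[t₁,t₂]/(t₁t₂)`. -/
abbrev CrossingRing (R : Type u) [CommRing R] (r : ℕ) : Type u :=
  MvPolynomial (Fin r × Fin 2) R ⧸
    Ideal.span (Set.range fun i : Fin r =>
      (MvPolynomial.X (i, 0) * MvPolynomial.X (i, 1) : MvPolynomial (Fin r × Fin 2) R))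

section K0BaseChange

open TensorProduct Polynomial

section Schanuel

variable {S F G M P : Type*} [CommRing S] [AddCommGroup F] [Module S F] [AddCommGroup G]
  [Module S G] [AddCommGroup M] [Module S M] [AddCommGroup P] [Module S P]

/-- **Schanuel's lemma**. -/
theorem exists_schanuel_equiv [Module.Projective S F] [Module.Projective S G]
    (f : F →ₗ[S] M) (g : G →ₗ[S] M) (hf : Function.Surjective f) (hg : Function.Surjective g) :
    Nonempty ((LinearMap.ker f × G) ≃ₗ[S] (LinearMap.ker g × F)) := by
  obtain ⟨a, ha⟩ := Module.projective_lifting_property g f hg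
  obtain ⟨b, hb⟩ := Module.projective_lifting_property f g hf
  have ha' (x) : g (a x) = f x := LinearMap.congr_fun ha x
  have hb' (y) : f (b y) = g y := LinearMap.congr_fun hb y
  refine ⟨LinearEquiv.ofLinearMap
    (LinearMap.prod
      (LinearMap.codRestrict _ (LinearMap.snd S _ _ - a ∘ₗ ((LinearMap.ker f).subtype.coprod b)) ?_)
      ((LinearMap.ker f).subtype.coprod b))
    (LinearMap.prod
      (LinearMap.codRestrict _ (LinearMap.snd S _ _ - b ∘ₗ ((LinearMap.ker g).subtype.coprod a)) ?_)
      ((LinearMap.ker g).subtype.coprod a)) ?_ ?_⟩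
  · rintro ⟨x, y⟩
    simp [ha', hb']
  · rintro ⟨x, y⟩
    simp [ha', hb']
  · refine LinearMap.ext fun ⟨x, y⟩ ↦ Prod.ext (Subtype.ext ?_) ?_ <;> simp
  · refine LinearMap.ext fun ⟨x, y⟩ ↦ Prod.ext (Subtype.ext ?_) ?_ <;> simp

/-- The kernel of `f × id` is the kernel of `f`. -/
def LinearMap.kerProdMapIdEquiv (f : F →ₗ[S] M) :
    LinearMap.ker (f.prodMap (LinearMap.id : P →ₗ[S] P)) ≃ₗ[S] LinearMap.ker f where
  toFun x := ⟨x.1.1, congrArg Prod.fst x.2⟩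
  invFun x := ⟨(x.1, 0), Prod.ext x.2 rfl⟩
  map_add' _ _ := rfl
  map_smul' _ _ := rfl
  left_inv x := Subtype.ext (Prod.ext rfl (congrArg Prod.snd x.2).symm)
  right_inv _ := rfl

end Schanuel

section Extended

variable (R S : Type u) [CommRing R] [CommRing S] [Algebra R S]

/-- An `S`-module is extended from `R` if it is isomorphic to `S ⊗[R] N` for a finitely generated
projective `R`-module `N`. -/
def IsExtended (M : Type u) [AddCommGroup M] [Module S M] : Prop :=
  ∃ (N : Type u) (_ : AddCommGroup N) (_ : Module R N),
    Module.Finite R N ∧ Module.Projective R N ∧ Nonempty (M ≃ₗ[S] S ⊗[R] N)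

/-- An `S`-module is stably extended from `R` if its sum with a suitable extended module is
extended. -/
def IsStablyExtended (M : Type u) [AddCommGroup M] [Module S M] : Prop :=
  ∃ (N₁ N₂ : Type u) (_ : AddCommGroup N₁) (_ : Module R N₁) (_ : AddCommGroup N₂)
    (_ : Module R N₂), Module.Finite R N₁ ∧ Module.Projective R N₁ ∧
    Module.Finite R N₂ ∧ Module.Projective R N₂ ∧
    Nonempty ((M × (S ⊗[R] N₁)) ≃ₗ[S] S ⊗[R] N₂)

/-- The `S`-module `M` has a resolution of length `n` by modules extended from `R`. -/
def HasExtRes : ℕ → (M : Type u) → [AddCommGroup M] → [Module S M] → Prop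
  | 0, M, _, _ => IsExtended R S M
  | n + 1, M, _, _ => ∃ (F : Type u) (_ : AddCommGroup F) (_ : Module S F),
      IsExtended R S F ∧ ∃ f : F →ₗ[S] M, Function.Surjective f ∧ HasExtRes n (LinearMap.ker f)

variable {R S} {M M' : Type u} [AddCommGroup M] [Module S M] [AddCommGroup M'] [Module S M']

theorem isExtended_baseChange (N : Type u) [AddCommGroup N] [Module R N] [Module.Finite R N]
    [Module.Projective R N] : IsExtended R S (S ⊗[R] N) :=
  ⟨N, _, _, ‹_›, ‹_›, ⟨.refl _ _⟩⟩

namespace IsExtended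

theorem of_equiv (h : IsExtended R S M) (e : M ≃ₗ[S] M') : IsExtended R S M' := by
  obtain ⟨N, _, _, h₁, h₂, ⟨e'⟩⟩ := h
  exact ⟨N, _, _, h₁, h₂, ⟨e.symm ≪≫ₗ e'⟩⟩

theorem projective (h : IsExtended R S M) : Module.Projective S M := by
  obtain ⟨N, _, _, h₁, h₂, ⟨e⟩⟩ := h
  exact Module.Projective.of_equiv e.symm

theorem prod (h : IsExtended R S M) (h' : IsExtended R S M') : IsExtended R S (M × M') := by
  obtain ⟨N, _, _, h₁, h₂, ⟨e⟩⟩ := h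
  obtain ⟨N', _, _, h₁', h₂', ⟨e'⟩⟩ := h'
  exact ⟨N × N', _, _, inferInstance, inferInstance,
    ⟨e.prodCongr e' ≪≫ₗ (TensorProduct.prodRight R S S N N').symm⟩⟩

theorem of_subsingleton [Subsingleton M] : IsExtended R S M :=
  ⟨PUnit, _, _, inferInstance, inferInstance, ⟨0, 0, fun _ ↦ Subsingleton.elim _ _, fun x ↦ by
    simp [Subsingleton.elim x 0]⟩⟩

end IsExtended

theorem IsStablyExtended.of_equiv_prod {L₁ L₂ : Type u} [AddCommGroup L₁] [Module S L₁]
    [AddCommGroup L₂] [Module S L₂] (h₁ : IsExtended R S L₁) (h₂ : IsExtended R S L₂)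
    (e : (M × L₁) ≃ₗ[S] L₂) : IsStablyExtended R S M := by
  obtain ⟨N, _, _, hN, hN', ⟨e₁⟩⟩ := h₁
  obtain ⟨N', _, _, hN₂, hN₂', ⟨e₂⟩⟩ := h₂
  exact ⟨N, N', _, _, _, _, hN, hN', hN₂, hN₂',
    ⟨(LinearEquiv.refl S M).prodCongr e₁.symm ≪≫ₗ e ≪≫ₗ e₂⟩⟩

namespace HasExtRes

theorem of_equiv {n : ℕ} (h : HasExtRes R S n M) (e : M ≃ₗ[S] M') : HasExtRes R S n M' := by
  induction n generalizing M M' with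
  | zero => exact IsExtended.of_equiv h e
  | succ n ih =>
    obtain ⟨F, _, _, hF, f, hf, h⟩ := h
    exact ⟨F, _, _, hF, e.toLinearMap ∘ₗ f, e.surjective.comp hf,
      ih h (LinearEquiv.ofEq _ _ (LinearEquiv.ker_comp e f).symm)⟩

theorem prod_extended {n : ℕ} (h : HasExtRes R S n M) (h' : IsExtended R S M') :
    HasExtRes R S n (M × M') := by
  cases n with
  | zero => exact IsExtended.prod h h'
  | succ n =>
    obtain ⟨F, _, _, hF, f, hf, h⟩ := h
    exact ⟨F × M', _, _, hF.prod h', f.prodMap .id, hf.prodMap Function.surjective_id,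
      h.of_equiv f.kerProdMapIdEquiv.symm⟩

/-- A projective module that is the difference of two modules with finite resolutions by extended
modules is stably extended. -/
theorem isStablyExtended {n : ℕ} {A L P : Type u} [AddCommGroup A] [Module S A]
    [AddCommGroup L] [Module S L] [AddCommGroup P] [Module S P] [Module.Projective S P]
    (hA : HasExtRes R S n A) (hL : HasExtRes R S n L) (e : (A × P) ≃ₗ[S] L) :
    IsStablyExtended R S P := by
  induction n generalizing A L with
  | zero => exact .of_equiv_prod hA hL (LinearEquiv.prodComm S P A ≪≫ₗ e)
  | succ n ih =>
    obtain ⟨F, _, _, hF, f, hf, hA⟩ := hA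
    obtain ⟨G, _, _, hG, g, hg, hL⟩ := hL
    have := hF.projective
    have := hG.projective
    obtain ⟨s⟩ := exists_schanuel_equiv (e.toLinearMap ∘ₗ f.prodMap (LinearMap.id : P →ₗ[S] P)) g
      (e.surjective.comp (hf.prodMap Function.surjective_id)) hg
    have k : LinearMap.ker (e.toLinearMap ∘ₗ f.prodMap (LinearMap.id : P →ₗ[S] P)) ≃ₗ[S]
        LinearMap.ker f :=
      LinearEquiv.ofEq _ _ (LinearEquiv.ker_comp e _) ≪≫ₗ f.kerProdMapIdEquiv
    exact ih (hL.prod_extended hF) (hA.prod_extended hG)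
      (LinearEquiv.prodAssoc S _ _ _ ≪≫ₗ s.symm ≪≫ₗ k.prodCongr (.refl S G))

end HasExtRes

end Extended

section Regular

open CategoryTheory

/-- Every finitely generated module has finite projective dimension. -/
def FiniteProjDim (R : Type u) [CommRing R] : Prop :=
  ∀ (M : Type u) [AddCommGroup M] [Module R M] [Module.Finite R M],
    ∃ n : ℕ, HasProjectiveDimensionLT (ModuleCat.of R M) n

theorem HasFPD.hasProjectiveDimensionLT {R : Type u} [CommRing R] {n : ℕ} {M : ModuleCat.{u} R}
    (h : HasFPD R n M) : HasProjectiveDimensionLT M (n + 1) := by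
  induction n generalizing M with
  | zero =>
    have : Module.Projective R M := h
    have : Projective M := (IsProjective.iff_projective M).1 this
    infer_instance
  | succ n ih =>
    obtain ⟨P, f, hP, hf, h⟩ := h
    have : Projective P := (IsProjective.iff_projective P).1 hP
    exact (LinearMap.shortExact_shortComplexKer hf).hasProjectiveDimensionLT_X₃ (n + 1) (ih h)
      (inferInstanceAs (HasProjectiveDimensionLT P _))

variable {R S : Type u} [CommRing R] [CommRing S] [Algebra R S]

theorem HasExtRes.hasProjectiveDimensionLT {n : ℕ} {M : Type u} [AddCommGroup M] [Module S M]
    (h : HasExtRes R S n M) : HasProjectiveDimensionLT (ModuleCat.of S M) (n + 1) := by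
  induction n generalizing M with
  | zero =>
    have : Module.Projective S M := IsExtended.projective h
    have : Projective (ModuleCat.of S M) := (IsProjective.iff_projective M).1 this
    infer_instance
  | succ n ih =>
    obtain ⟨F, _, _, hF, f, hf, h⟩ := h
    have := hF.projective
    have : Projective (ModuleCat.of S F) := (IsProjective.iff_projective F).1 this
    exact (LinearMap.shortExact_shortComplexKer hf).hasProjectiveDimensionLT_X₃ (n + 1) (ih h)
      (inferInstanceAs (HasProjectiveDimensionLT (ModuleCat.of S F) _))

/-- The kernel of a flat base change is the base change of the kernel. -/
noncomputable def LinearMap.kerBaseChangeEquiv [Module.Flat R S] {M N : Type*} [AddCommGroup M]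
    [Module R M] [AddCommGroup N] [Module R N] (f : M →ₗ[R] N) :
    S ⊗[R] LinearMap.ker f ≃ₗ[S] LinearMap.ker (f.baseChange S) :=
  have hex : Function.Exact ((LinearMap.ker f).subtype.baseChange S) (f.baseChange S) :=
    Module.Flat.lTensor_exact S f.exact_subtype_ker_map
  LinearEquiv.ofInjective ((LinearMap.ker f).subtype.baseChange S)
    (Module.Flat.lTensor_preserves_injective_linearMap (M := S) _ (Submodule.injective_subtype _))
    ≪≫ₗ LinearEquiv.ofEq _ _ (LinearMap.exact_iff.1 hex).symm

theorem hasExtRes_baseChange [IsNoetherianRing R] [Module.Flat R S] {n : ℕ} {M : Type u}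
    [AddCommGroup M] [Module R M] [Module.Finite R M]
    (h : HasProjectiveDimensionLT (ModuleCat.of R M) (n + 1)) : HasExtRes R S n (S ⊗[R] M) := by
  induction n generalizing M with
  | zero =>
    have : Module.Projective R M := (IsProjective.iff_projective M).2
      (projective_iff_hasProjectiveDimensionLT_one.2 h)
    exact isExtended_baseChange M
  | succ n ih =>
    obtain ⟨F, _, _, _, _, f, hf⟩ := Module.exists_finite_presentation R M
    have : Projective (ModuleCat.of R F) := (IsProjective.iff_projective F).1 inferInstance
    exact ⟨S ⊗[R] F, _, _, isExtended_baseChange F, f.baseChange S,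
      LinearMap.lTensor_surjective S hf,
      (ih ((LinearMap.shortExact_shortComplexKer hf).hasProjectiveDimensionLT_X₁ (n + 1)
        (inferInstanceAs (HasProjectiveDimensionLT (ModuleCat.of R F) _)) h)).of_equiv
          f.kerBaseChangeEquiv⟩

end Regular

section CharSeq

variable {R : Type u} [CommRing R] {M : Type u} [AddCommGroup M] [Module R M] [Module R[X] M]
  [IsScalarTower R R[X] M]

/-- Multiplication by `X` as an `R`-linear map. -/
noncomputable def mulX (R M : Type*) [CommRing R] [AddCommGroup M] [Module R M] [Module R[X] M]
    [IsScalarTower R R[X] M] : M →ₗ[R] M :=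
  (LinearMap.lsmul R[X] M X).restrictScalars R

@[simp] theorem mulX_apply (m : M) : mulX R M m = (X : R[X]) • m := rfl

variable (L : Submodule R M)

/-- The largest submodule of `L` which multiplication by `X` sends into `L`. -/
noncomputable def shiftSubmodule : Submodule R M := L ⊓ L.comap (mulX R M)

/-- Multiplication by `X` from `shiftSubmodule L` to `L`. -/
noncomputable def shiftMul : shiftSubmodule L →ₗ[R] L :=
  ((mulX R M).domRestrict (shiftSubmodule L)).codRestrict L fun m ↦ m.2.2

/-- The inclusion of `shiftSubmodule L` in `L`. -/
noncomputable def shiftIncl : shiftSubmodule L →ₗ[R] L :=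
  Submodule.inclusion inf_le_left

@[simp] theorem coe_shiftMul (m : shiftSubmodule L) :
    (shiftMul L m : M) = (X : R[X]) • (m : M) := rfl

@[simp] theorem coe_shiftIncl (m : shiftSubmodule L) : (shiftIncl L m : M) = m := rfl

/-- The map `s ⊗ a ↦ X s ⊗ a - s ⊗ X a`. -/
noncomputable def charMap : R[X] ⊗[R] shiftSubmodule L →ₗ[R[X]] R[X] ⊗[R] L :=
  (X : R[X]) • (shiftIncl L).baseChange R[X] - (shiftMul L).baseChange R[X]

/-- The action map `s ⊗ m ↦ s m`. -/
noncomputable def actMap : R[X] ⊗[R] L →ₗ[R[X]] M :=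
  LinearMap.liftBaseChange R[X] L.subtype

@[simp] theorem actMap_tmul (s : R[X]) (m : L) : actMap L (s ⊗ₜ m) = s • (m : M) := by
  simp [actMap]

@[simp] theorem charMap_tmul (s : R[X]) (m : shiftSubmodule L) :
    charMap L (s ⊗ₜ m) = (X * s) ⊗ₜ shiftIncl L m - s ⊗ₜ shiftMul L m := by
  simp [charMap, TensorProduct.smul_tmul']

theorem actMap_charMap (z) : actMap L (charMap L z) = 0 := by
  have : actMap L ∘ₗ charMap L = 0 := by
    ext m
    simp
  exact LinearMap.congr_fun this z

/-- The `n`-th coefficient of an element of `R[X] ⊗[R] N`. -/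
noncomputable def tensorCoeff (N : Type*) [AddCommGroup N] [Module R N] (n : ℕ) :
    R[X] ⊗[R] N →ₗ[R] N :=
  (TensorProduct.lid R N).toLinearMap ∘ₗ (lcoeff R n).rTensor N

@[simp] theorem tensorCoeff_tmul (N : Type*) [AddCommGroup N] [Module R N] (n : ℕ) (s : R[X])
    (m : N) : tensorCoeff N n (s ⊗ₜ m) = s.coeff n • m := by
  simp [tensorCoeff]

theorem eventually_tensorCoeff_eq_zero {N : Type*} [AddCommGroup N] [Module R N]
    (z : R[X] ⊗[R] N) : ∃ d, ∀ n, d ≤ n → tensorCoeff N n z = 0 := by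
  induction z with
  | zero => exact ⟨0, by simp⟩
  | tmul s m =>
    exact ⟨s.natDegree + 1, fun n hn ↦ by simp [coeff_eq_zero_of_natDegree_lt hn]⟩
  | add x y hx hy =>
    obtain ⟨d, hd⟩ := hx
    obtain ⟨e, he⟩ := hy
    exact ⟨max d e, fun n hn ↦ by
      rw [map_add, hd n (le_of_max_le_left hn), he n (le_of_max_le_right hn), add_zero]⟩

theorem eq_sum_tensorCoeff {N : Type*} [AddCommGroup N] [Module R N] (z : R[X] ⊗[R] N) :
    ∃ d, ∀ n, d ≤ n → z = ∑ i ∈ Finset.range n, (X ^ i : R[X]) ⊗ₜ tensorCoeff N i z := by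
  induction z with
  | zero => exact ⟨0, by simp⟩
  | tmul s m =>
    refine ⟨s.natDegree + 1, fun n hn ↦ ?_⟩
    conv_lhs => rw [s.as_sum_range' n hn, TensorProduct.sum_tmul]
    refine Finset.sum_congr rfl fun i _ ↦ ?_
    rw [tensorCoeff_tmul, TensorProduct.tmul_smul, TensorProduct.smul_tmul', smul_X_eq_monomial]
  | add x y hx hy =>
    obtain ⟨d, hd⟩ := hx
    obtain ⟨e, he⟩ := hy
    refine ⟨max d e, fun n hn ↦ ?_⟩
    conv_lhs => rw [hd n (le_of_max_le_left hn), he n (le_of_max_le_right hn)]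
    simp only [map_add, TensorProduct.tmul_add, Finset.sum_add_distrib]

theorem tensorCoeff_charMap (n : ℕ) (z : R[X] ⊗[R] shiftSubmodule L) :
    tensorCoeff L (n + 1) (charMap L z) =
      shiftIncl L (tensorCoeff _ n z) - shiftMul L (tensorCoeff _ (n + 1) z) := by
  induction z with
  | zero => simp
  | tmul s m => simp [coeff_X_mul]
  | add x y hx hy => simp only [map_add, hx, hy]; abel

theorem charMap_injective : Function.Injective (charMap L) := by
  rw [injective_iff_map_eq_zero]
  intro z hz
  obtain ⟨d, hd⟩ := eventually_tensorCoeff_eq_zero z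
  have h0 (k n : ℕ) (hn : d ≤ n + k) : tensorCoeff _ n z = 0 := by
    induction k generalizing n with
    | zero => exact hd n hn
    | succ k ih =>
      have h := tensorCoeff_charMap L n z
      rw [hz, ih (n + 1) (by omega), map_zero, map_zero, sub_zero] at h
      exact Submodule.inclusion_injective inf_le_left (h.symm.trans (map_zero _).symm)
  obtain ⟨e, he⟩ := eq_sum_tensorCoeff z
  rw [he e le_rfl]
  exact Finset.sum_eq_zero fun i _ ↦ by rw [h0 d i (by omega), TensorProduct.tmul_zero]

variable (R M) in
/-- A finitely generated `R[X]`-module over a Noetherian ring `R` has a presentation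
`0 → R[X] ⊗ A → R[X] ⊗ L → M → 0` with `A` and `L` finitely generated over `R`. -/
theorem exists_charSeq [IsNoetherianRing R] [Module.Finite R[X] M] :
    ∃ L : Submodule R M, L.FG ∧ Function.Surjective (actMap L) ∧
      LinearMap.ker (actMap L) = LinearMap.range (charMap L) := by
  obtain ⟨b, φ, hφ⟩ := Module.Finite.exists_fin' R[X] M
  obtain ⟨T, hT⟩ := IsNoetherian.noetherian (LinearMap.ker φ)
  obtain ⟨d, hd⟩ : ∃ d, ∀ k ∈ T, ∀ i, (k i).natDegree ≤ d :=
    ⟨T.sup fun k ↦ Finset.univ.sup fun i ↦ (k i).natDegree, fun k hk i ↦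
      (Finset.le_sup (f := fun i ↦ (k i).natDegree) (Finset.mem_univ i)).trans
        (Finset.le_sup (f := fun k : Fin b → R[X] ↦ Finset.univ.sup fun i ↦ (k i).natDegree) hk)⟩
  let m (i : Fin b) : M := φ (Pi.single i 1)
  have hφm (s : Fin b → R[X]) : φ s = ∑ i, s i • m i := by
    conv_lhs => rw [← Finset.univ_sum_single s, map_sum]
    refine Finset.sum_congr rfl fun i _ ↦ ?_
    rw [← map_smul, ← Pi.single_smul, smul_eq_mul, mul_one]
  let L : Submodule R M := Submodule.span R
    (Set.range fun x : Fin b × Fin (d + 1) ↦ (X ^ (x.2 : ℕ) : R[X]) • m x.1)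
  have hL (i : Fin b) (j : ℕ) (hj : j ≤ d) : (X ^ j : R[X]) • m i ∈ L :=
    Submodule.subset_span ⟨(i, ⟨j, by omega⟩), rfl⟩
  have hLp (i : Fin b) (p : R[X]) (hp : p.natDegree ≤ d) : p • m i ∈ L := by
    rw [p.as_sum_range' (d + 1) (by omega), Finset.sum_smul]
    refine Submodule.sum_mem _ fun j hj ↦ ?_
    rw [← smul_X_eq_monomial, smul_assoc]
    exact L.smul_mem _ (hL i j (by simpa [Nat.lt_succ_iff] using hj))
  have hL1 (i : Fin b) : m i ∈ L := by simpa using hL i 0 (by omega)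
  let π := (LinearMap.range (charMap L)).mkQ
  -- modulo the image of `charMap`, powers of `X` move across the tensor sign
  have hpow (i : Fin b) (j : ℕ) (hj : j ≤ d) :
      π ((1 : R[X]) ⊗ₜ ⟨(X ^ j : R[X]) • m i, hL i j hj⟩) =
        (X ^ j : R[X]) • π ((1 : R[X]) ⊗ₜ ⟨m i, hL1 i⟩) := by
    induction j with
    | zero => simp
    | succ j ih =>
      conv_rhs => rw [pow_succ', mul_smul, ← ih (by omega)]
      rw [← LinearMap.map_smul π, ← sub_eq_zero, ← map_sub,
        Submodule.mkQ_apply, Submodule.Quotient.mk_eq_zero, ← neg_mem_iff, neg_sub]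
      have hmem : (X : R[X]) • (X ^ j : R[X]) • m i ∈ L := by
        rw [← mul_smul, ← pow_succ']; exact hL i _ hj
      refine ⟨1 ⊗ₜ ⟨(X ^ j : R[X]) • m i, hL i j (by omega), hmem⟩, ?_⟩
      rw [charMap_tmul, TensorProduct.smul_tmul', smul_eq_mul]
      congr 2
      exact Subtype.ext (by simp [pow_succ', mul_smul])
  have hpoly (i : Fin b) (p : R[X]) (hp : p.natDegree ≤ d) :
      p • π ((1 : R[X]) ⊗ₜ ⟨m i, hL1 i⟩) = π ((1 : R[X]) ⊗ₜ ⟨p • m i, hLp i p hp⟩) := by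
    have : (⟨p • m i, hLp i p hp⟩ : L) =
        ∑ j : Fin (d + 1), p.coeff j • ⟨(X ^ (j : ℕ) : R[X]) • m i, hL i j (by omega)⟩ := by
      refine Subtype.ext ?_
      simp only [Submodule.coe_sum, Submodule.coe_smul]
      conv_lhs => rw [p.as_sum_range' (d + 1) (by omega), Finset.sum_smul, Finset.sum_range]
      exact Finset.sum_congr rfl fun j _ ↦ by rw [← smul_X_eq_monomial, smul_assoc]
    rw [this, TensorProduct.tmul_sum, map_sum]
    conv_lhs => rw [p.as_sum_range' (d + 1) (by omega), Finset.sum_smul, Finset.sum_range]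
    refine Finset.sum_congr rfl fun j _ ↦ ?_
    rw [← smul_X_eq_monomial, smul_assoc, TensorProduct.tmul_smul, ← hpow i j (by omega)]
    exact (LinearMap.map_smul_of_tower π _ _).symm
  let g : (Fin b → R[X]) →ₗ[R[X]] (R[X] ⊗[R] L ⧸ LinearMap.range (charMap L)) :=
    ∑ i, (LinearMap.toSpanSingleton R[X] _ (π ((1 : R[X]) ⊗ₜ ⟨m i, hL1 i⟩))) ∘ₗ
      LinearMap.proj i
  have hg (s) : g s = ∑ i, s i • π ((1 : R[X]) ⊗ₜ ⟨m i, hL1 i⟩) := by simp [g]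
  have hgker (s) (hs : φ s = 0) : g s = 0 := by
    have : LinearMap.ker φ ≤ LinearMap.ker g := by
      rw [← hT, Submodule.span_le]
      intro k hk
      have hk0 : φ k = 0 := by
        have : k ∈ LinearMap.ker φ := hT ▸ Submodule.subset_span hk
        exact this
      have hsum : ∑ i, (⟨k i • m i, hLp i (k i) (hd k hk i)⟩ : L) = 0 :=
        Subtype.ext (by simpa [hφm] using hk0)
      rw [SetLike.mem_coe, LinearMap.mem_ker, hg,
        Finset.sum_congr rfl fun i _ ↦ hpoly i (k i) (hd k hk i), ← map_sum,
        ← TensorProduct.tmul_sum, hsum, TensorProduct.tmul_zero, map_zero]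
    exact this hs
  have hgsurj (z : R[X] ⊗[R] L) : ∃ s, g s = π z := by
    induction z with
    | zero => exact ⟨0, by simp⟩
    | add x y hx hy =>
      obtain ⟨s, hs⟩ := hx
      obtain ⟨t, ht⟩ := hy
      exact ⟨s + t, by simp [hs, ht]⟩
    | tmul p l =>
      suffices ∃ s, g s = π (1 ⊗ₜ l) by
        obtain ⟨s, hs⟩ := this
        exact ⟨p • s, by rw [map_smul, hs, ← map_smul, TensorProduct.smul_tmul', smul_eq_mul,
          mul_one]⟩
      obtain ⟨l, hl⟩ := l
      induction hl using Submodule.span_induction with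
      | mem x hx =>
        obtain ⟨⟨i, j⟩, rfl⟩ := hx
        refine ⟨Pi.single i (X ^ (j : ℕ)), ?_⟩
        rw [hpow i j (by omega), hg, Finset.sum_eq_single i] <;> simp +contextual
      | zero => exact ⟨0, by rw [map_zero]; exact ((congrArg π (TensorProduct.tmul_zero L 1)).trans
          (map_zero π)).symm⟩
      | add x y hx hy hx' hy' =>
        obtain ⟨s, hs⟩ := hx'
        obtain ⟨t, ht⟩ := hy'
        refine ⟨s + t, ?_⟩
        rw [map_add, hs, ht, ← map_add, ← TensorProduct.tmul_add]
        rfl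
      | smul r x hx hx' =>
        obtain ⟨s, hs⟩ := hx'
        refine ⟨r • s, ?_⟩
        rw [LinearMap.map_smul_of_tower g, hs, ← LinearMap.map_smul_of_tower π,
          ← TensorProduct.tmul_smul]
        rfl
  refine ⟨L, Submodule.fg_span (Set.finite_range _), fun x ↦ ?_, le_antisymm (fun z hz ↦ ?_) ?_⟩
  · obtain ⟨s, rfl⟩ := hφ x
    refine ⟨∑ i, s i ⊗ₜ ⟨m i, hL1 i⟩, ?_⟩
    simp [hφm]
  · obtain ⟨s, hs⟩ := hgsurj z
    have hbar : LinearMap.range (charMap L) ≤ LinearMap.ker (actMap L) := by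
      rintro _ ⟨y, rfl⟩
      exact actMap_charMap L y
    have hφg : φ s = 0 := by
      have h1 : (LinearMap.range (charMap L)).liftQ (actMap L) hbar (g s) = φ s := by
        simp [hg, π, hφm]
      have h2 : (LinearMap.range (charMap L)).liftQ (actMap L) hbar (π z) = 0 := by
        simpa [π] using hz
      rw [← h1, hs, h2]
    rw [hgker s hφg] at hs
    exact (Submodule.Quotient.mk_eq_zero _).1 hs.symm
  · rintro _ ⟨y, rfl⟩
    exact actMap_charMap L y

end CharSeq

section PolynomialRing

open CategoryTheory

variable {R : Type u} [CommRing R] [IsNoetherianRing R]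

/-- Over a polynomial ring, a finitely generated module is the quotient of two modules with finite
resolutions by extended modules. -/
theorem FiniteProjDim.exists_exact (h : FiniteProjDim R) (M : Type u) [AddCommGroup M]
    [Module R[X] M] [Module.Finite R[X] M] :
    ∃ (A L : Type u) (_ : AddCommGroup A) (_ : Module R[X] A) (_ : AddCommGroup L)
      (_ : Module R[X] L) (n : ℕ) (f : A →ₗ[R[X]] L) (g : L →ₗ[R[X]] M),
      HasExtRes R R[X] n A ∧ HasExtRes R R[X] n L ∧ Function.Injective f ∧
      Function.Exact f g ∧ Function.Surjective g := by
  let _ : Module R M := Module.compHom M (C : R →+* R[X])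
  have : IsScalarTower R R[X] M := .of_algebraMap_smul fun _ _ ↦ rfl
  obtain ⟨L, hL, hsurj, hker⟩ := exists_charSeq R M
  have : Module.Finite R L := Module.Finite.iff_fg.2 hL
  have : Module.Finite R (shiftSubmodule L) :=
    Module.Finite.of_injective (shiftIncl L) (Submodule.inclusion_injective _)
  obtain ⟨n, hn⟩ := h (shiftSubmodule L)
  obtain ⟨k, hk⟩ := h L
  exact ⟨_, _, _, _, _, _, max n k, charMap L, actMap L,
    hasExtRes_baseChange (hasProjectiveDimensionLT_of_ge _ n _ (by omega)),
    hasExtRes_baseChange (hasProjectiveDimensionLT_of_ge _ k _ (by omega)),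
    charMap_injective L, LinearMap.exact_iff.2 hker, hsurj⟩

theorem FiniteProjDim.polynomial (h : FiniteProjDim R) : FiniteProjDim R[X] := by
  intro M _ _ _
  obtain ⟨A, L, _, _, _, _, n, f, g, hA, hL, hf, hfg, hg⟩ := h.exists_exact M
  refine ⟨n + 2, ?_⟩
  let e : A ≃ₗ[R[X]] LinearMap.ker g :=
    LinearEquiv.ofInjective f hf ≪≫ₗ LinearEquiv.ofEq _ _ (LinearMap.exact_iff.1 hfg).symm
  have h₁ := (hA.of_equiv e).hasProjectiveDimensionLT
  have h₂ := hL.hasProjectiveDimensionLT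
  exact (LinearMap.shortExact_shortComplexKer hg).hasProjectiveDimensionLT_X₃ (n + 1) h₁
    (hasProjectiveDimensionLT_of_ge _ (n + 1) _ (by omega))

theorem FiniteProjDim.isStablyExtended (h : FiniteProjDim R) (P : Type u) [AddCommGroup P]
    [Module R[X] P] [Module.Finite R[X] P] [Module.Projective R[X] P] :
    IsStablyExtended R R[X] P := by
  obtain ⟨A, L, _, _, _, _, n, f, g, hA, hL, hf, hfg, hg⟩ := h.exists_exact P
  obtain ⟨l, hl⟩ := Module.projective_lifting_property g .id hg
  exact hA.isStablyExtended hL (hfg.splitSurjectiveEquiv hf ⟨l, hl⟩).1.symm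

end PolynomialRing

section StablyExtending

/-- Every finitely generated projective `S`-module is stably extended from `R`; equivalently, the
base change map on `K₀` is surjective. -/
def K0Surjective (R S : Type u) [CommRing R] [CommRing S] [Algebra R S] : Prop :=
  ∀ (P : Type u) [AddCommGroup P] [Module S P] [Module.Finite S P] [Module.Projective S P],
    IsStablyExtended R S P

variable {R S T : Type u} [CommRing R] [CommRing S] [CommRing T] [Algebra R S] [Algebra R T]
  [Algebra S T] [IsScalarTower R S T]

theorem IsExtended.restrict {M : Type u} [AddCommGroup M] [Module T M] (h : IsExtended R T M) :
    IsExtended S T M := by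
  obtain ⟨N, _, _, h₁, h₂, ⟨e⟩⟩ := h
  exact ⟨S ⊗[R] N, _, _, inferInstance, inferInstance,
    ⟨e ≪≫ₗ (TensorProduct.AlgebraTensorModule.cancelBaseChange R S T T N).symm⟩⟩

theorem IsStablyExtended.trans (h : K0Surjective R S) {P : Type u} [AddCommGroup P] [Module T P]
    (hP : IsStablyExtended S T P) : IsStablyExtended R T P := by
  obtain ⟨N₁, N₂, _, _, _, _, _, _, _, _, ⟨e⟩⟩ := hP
  obtain ⟨L₁, L₂, _, _, _, _, _, _, _, _, ⟨e₁⟩⟩ := h N₁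
  obtain ⟨L₃, L₄, _, _, _, _, _, _, _, _, ⟨e₂⟩⟩ := h N₂
  let k (L : Type u) [AddCommGroup L] [Module R L] :=
    TensorProduct.AlgebraTensorModule.cancelBaseChange R S T T L
  let e₁' : ((T ⊗[S] N₁) × (T ⊗[R] L₁)) ≃ₗ[T] T ⊗[R] L₂ :=
    (LinearEquiv.refl T _).prodCongr (k L₁).symm ≪≫ₗ
      (TensorProduct.prodRight S T T N₁ (S ⊗[R] L₁)).symm ≪≫ₗ e₁.baseChange S T _ _ ≪≫ₗ k L₂
  let e₂' : ((T ⊗[S] N₂) × (T ⊗[R] L₃)) ≃ₗ[T] T ⊗[R] L₄ :=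
    (LinearEquiv.refl T _).prodCongr (k L₃).symm ≪≫ₗ
      (TensorProduct.prodRight S T T N₂ (S ⊗[R] L₃)).symm ≪≫ₗ e₂.baseChange S T _ _ ≪≫ₗ k L₄
  refine .of_equiv_prod ((isExtended_baseChange L₂).prod (isExtended_baseChange L₃))
    ((isExtended_baseChange L₄).prod (isExtended_baseChange L₁)) ?_
  exact (LinearEquiv.refl T P).prodCongr (e₁'.symm.prodCongr (.refl T _)) ≪≫ₗ
    (LinearEquiv.refl T P).prodCongr (LinearEquiv.prodAssoc T _ _ _) ≪≫ₗ
    (LinearEquiv.prodAssoc T _ _ _).symm ≪≫ₗ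
    e.prodCongr (LinearEquiv.prodComm T _ _) ≪≫ₗ
    (LinearEquiv.prodAssoc T _ _ _).symm ≪≫ₗ
    e₂'.prodCongr (.refl T _)

theorem K0Surjective.trans (h : K0Surjective R S) (h' : K0Surjective S T) : K0Surjective R T :=
  fun P _ _ _ _ ↦ (h' P).trans h

theorem K0Surjective.of_tower (S : Type u) [CommRing S] [Algebra R S] [Algebra S T]
    [IsScalarTower R S T] (h : K0Surjective R T) : K0Surjective S T := by
  intro P _ _ _ _
  obtain ⟨N₁, N₂, _, _, _, _, _, _, _, _, ⟨e⟩⟩ := h P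
  exact .of_equiv_prod (isExtended_baseChange N₁).restrict (isExtended_baseChange N₂).restrict e

theorem K0Surjective.of_bijective (h : Function.Bijective (algebraMap R S)) :
    K0Surjective R S := by
  intro P _ _ _ _
  let e := RingEquiv.ofBijective _ h
  let _ : Algebra S R := e.symm.toRingHom.toAlgebra
  have : IsScalarTower S R S := .of_algebraMap_eq fun x ↦ (e.apply_symm_apply x).symm
  have hP : IsExtended R S P := ⟨R ⊗[S] P, _, _, inferInstance, inferInstance,
    ⟨(TensorProduct.AlgebraTensorModule.cancelBaseChange S R S S P ≪≫ₗ
      TensorProduct.lid S P).symm⟩⟩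
  exact .of_equiv_prod (L₁ := PUnit) .of_subsingleton hP
    (LinearEquiv.prodUnique)

end StablyExtending

section Milnor

variable (C D₁ D₂ E : Type u) [CommRing C] [CommRing D₁] [CommRing D₂]
  [CommRing E] [Algebra C D₁] [Algebra C D₂] [Algebra C E] [Algebra D₁ E] [Algebra D₂ E]
  [IsScalarTower C D₁ E] [IsScalarTower C D₂ E]

/-- `C` is the fibre product of `D₁` and `D₂` over `E`. -/
structure IsFibreProduct : Prop where
  eq_zero : ∀ c : C, algebraMap C D₁ c = 0 → algebraMap C D₂ c = 0 → c = 0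
  exists_lift : ∀ (d₁ : D₁) (d₂ : D₂), algebraMap D₁ E d₁ = algebraMap D₂ E d₂ →
    ∃ c : C, algebraMap C D₁ c = d₁ ∧ algebraMap C D₂ c = d₂

/-- The map `D ⊗[C] P → E ⊗[C] P` induced by `D → E`. -/
noncomputable def tensorMap (C D E : Type u) [CommRing C] [CommRing D] [CommRing E] [Algebra C D]
    [Algebra C E] [Algebra D E] [IsScalarTower C D E] (P : Type u) [AddCommGroup P] [Module C P] :
    D ⊗[C] P →ₗ[C] E ⊗[C] P :=
  (IsScalarTower.toAlgHom C D E).toLinearMap.rTensor P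

@[simp] theorem tensorMap_tmul (C D E : Type u) [CommRing C] [CommRing D] [CommRing E]
    [Algebra C D] [Algebra C E] [Algebra D E] [IsScalarTower C D E] (P : Type u) [AddCommGroup P]
    [Module C P] (d : D) (p : P) : tensorMap C D E P (d ⊗ₜ p) = algebraMap D E d ⊗ₜ p := by
  simp [tensorMap]

variable {C D₁ D₂ E} (hsq : IsFibreProduct C D₁ D₂ E)

section FibreProductModule

variable (P : Type u) [AddCommGroup P] [Module C P]

variable (C D₁ D₂) in
/-- The diagonal map `P → (D₁ ⊗[C] P) × (D₂ ⊗[C] P)`. -/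
noncomputable def fibreDiag : P →ₗ[C] (D₁ ⊗[C] P) × (D₂ ⊗[C] P) :=
  (TensorProduct.mk C D₁ P 1).prod (TensorProduct.mk C D₂ P 1)

@[simp] theorem fibreDiag_apply (p : P) :
    fibreDiag C D₁ D₂ P p = ((1 : D₁) ⊗ₜ p, (1 : D₂) ⊗ₜ p) := rfl

include hsq

omit [Algebra C E] [IsScalarTower C D₁ E] [IsScalarTower C D₂ E] in
theorem IsFibreProduct.fibreDiag_injective [Module.Flat C P] :
    Function.Injective (fibreDiag C D₁ D₂ P) := by
  let f : C →ₗ[C] D₁ × D₂ := (Algebra.linearMap C D₁).prod (Algebra.linearMap C D₂)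
  have hf : Function.Injective f := by
    rw [injective_iff_map_eq_zero]
    intro c hc
    exact hsq.eq_zero c (congrArg Prod.fst hc) (congrArg Prod.snd hc)
  have h := Module.Flat.rTensor_preserves_injective_linearMap (M := P) f hf
  have heq : fibreDiag C D₁ D₂ P = (TensorProduct.prodLeft C C D₁ D₂ P).toLinearMap ∘ₗ
      f.rTensor P ∘ₗ (TensorProduct.lid C P).symm.toLinearMap := by
    ext p <;> simp [f]
  rw [heq]
  exact (TensorProduct.prodLeft C C D₁ D₂ P).injective.comp
    (h.comp (TensorProduct.lid C P).symm.injective)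

theorem IsFibreProduct.mem_range_fibreDiag [Module.Flat C P] (z : (D₁ ⊗[C] P) × (D₂ ⊗[C] P)) :
    z ∈ LinearMap.range (fibreDiag C D₁ D₂ P) ↔
      tensorMap C D₁ E P z.1 = tensorMap C D₂ E P z.2 := by
  constructor
  · rintro ⟨p, rfl⟩
    simp
  intro hz
  let f : C →ₗ[C] D₁ × D₂ := (Algebra.linearMap C D₁).prod (Algebra.linearMap C D₂)
  let g : D₁ × D₂ →ₗ[C] E :=
    (IsScalarTower.toAlgHom C D₁ E).toLinearMap.coprod
      (-(IsScalarTower.toAlgHom C D₂ E).toLinearMap)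
  have hfg : Function.Exact f g := by
    rintro ⟨d₁, d₂⟩
    constructor
    · intro h
      obtain ⟨c, h₁, h₂⟩ := hsq.exists_lift d₁ d₂
        (by simpa [g, ← sub_eq_add_neg, sub_eq_zero] using h)
      exact ⟨c, Prod.ext h₁ h₂⟩
    · rintro ⟨c, hc⟩
      rw [← hc]
      simp [f, g]
  have hex := Module.Flat.rTensor_exact P hfg
  have hg : g.rTensor P = (tensorMap C D₁ E P).coprod (-tensorMap C D₂ E P) ∘ₗ
      (TensorProduct.prodLeft C C D₁ D₂ P).toLinearMap := by
    ext <;> simp [g, TensorProduct.neg_tmul]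
  have heq : fibreDiag C D₁ D₂ P = (TensorProduct.prodLeft C C D₁ D₂ P).toLinearMap ∘ₗ
      f.rTensor P ∘ₗ (TensorProduct.lid C P).symm.toLinearMap := by
    ext p <;> simp [f]
  obtain ⟨t, ht⟩ := (hex ((TensorProduct.prodLeft C C D₁ D₂ P).symm z)).1 (by
    simp [hg, hz])
  refine ⟨TensorProduct.lid C P t, ?_⟩
  rw [heq]
  simp [ht]

/-- Flat modules over a fibre product are isomorphic if their base changes are compatibly so. -/
theorem IsFibreProduct.nonempty_equiv [Module.Flat C P] (P' : Type u) [AddCommGroup P']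
    [Module C P'] [Module.Flat C P'] (a : D₁ ⊗[C] P ≃ₗ[D₁] D₁ ⊗[C] P')
    (b : D₂ ⊗[C] P ≃ₗ[D₂] D₂ ⊗[C] P') (γ : E ⊗[C] P ≃ₗ[E] E ⊗[C] P')
    (ha : ∀ z, tensorMap C D₁ E P' (a z) = γ (tensorMap C D₁ E P z))
    (hb : ∀ z, tensorMap C D₂ E P' (b z) = γ (tensorMap C D₂ E P z)) :
    Nonempty (P ≃ₗ[C] P') := by
  let e := (a.restrictScalars C).prodCongr (b.restrictScalars C)
  have he : (LinearMap.range (fibreDiag C D₁ D₂ P)).map e.toLinearMap =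
      LinearMap.range (fibreDiag C D₁ D₂ P') := by
    ext z
    obtain ⟨w, rfl⟩ := e.surjective z
    rw [hsq.mem_range_fibreDiag]
    have h1 : (e w ∈ (LinearMap.range (fibreDiag C D₁ D₂ P)).map e.toLinearMap) ↔
        w ∈ LinearMap.range (fibreDiag C D₁ D₂ P) := by
      simp
    rw [h1, hsq.mem_range_fibreDiag]
    simp [e, ha, hb]
  exact ⟨LinearEquiv.ofInjective _ (hsq.fibreDiag_injective P) ≪≫ₗ e.ofSubmodules _ _ he ≪≫ₗ
    (LinearEquiv.ofInjective _ (hsq.fibreDiag_injective P')).symm⟩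

end FibreProductModule

/-- A `D`-linear isomorphism of base changes induces an isomorphism after base change to a
`D`-algebra. -/
theorem exists_equiv_tensorMap {C D E : Type u} [CommRing C] [CommRing D] [CommRing E]
    [Algebra C D] [Algebra C E] [Algebra D E] [IsScalarTower C D E] {P P' : Type u}
    [AddCommGroup P] [Module C P] [AddCommGroup P'] [Module C P']
    (a : D ⊗[C] P ≃ₗ[D] D ⊗[C] P') :
    ∃ γ : E ⊗[C] P ≃ₗ[E] E ⊗[C] P', ∀ z, tensorMap C D E P' (a z) = γ (tensorMap C D E P z) := by
  let k (Q : Type u) [AddCommGroup Q] [Module C Q] :=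
    TensorProduct.AlgebraTensorModule.cancelBaseChange C D E E Q
  have hk (Q : Type u) [AddCommGroup Q] [Module C Q] (z : D ⊗[C] Q) :
      tensorMap C D E Q z = k Q (1 ⊗ₜ z) := by
    induction z with
    | zero => simp
    | tmul d q => simp [k, Algebra.algebraMap_eq_smul_one]
    | add x y hx hy => simp only [map_add, TensorProduct.tmul_add, hx, hy]
  refine ⟨(k P).symm ≪≫ₗ a.baseChange D E _ _ ≪≫ₗ k P', fun z ↦ ?_⟩
  simp [hk]

/-- If `B → C → E` is bijective then an isomorphism over `E` of modules extended from `B` descends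
to `B`. -/
theorem exists_descent {B C E : Type u} [CommRing B] [CommRing C] [CommRing E] [Algebra B C]
    [Algebra B E] [Algebra C E] [IsScalarTower B C E] (hE : Function.Bijective (algebraMap B E))
    {M M' : Type u} [AddCommGroup M] [Module B M] [AddCommGroup M'] [Module B M']
    (δ : E ⊗[C] (C ⊗[B] M) ≃ₗ[E] E ⊗[C] (C ⊗[B] M')) :
    ∃ d : M ≃ₗ[B] M', (d.baseChange B C _ _).baseChange C E _ _ = δ := by
  let τ (Q : Type u) [AddCommGroup Q] [Module B Q] : Q ≃ₗ[B] E ⊗[C] (C ⊗[B] Q) :=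
    (TensorProduct.lid B Q).symm ≪≫ₗ
      TensorProduct.congr (LinearEquiv.ofBijective (Algebra.linearMap B E) hE) (.refl B Q) ≪≫ₗ
      (TensorProduct.AlgebraTensorModule.cancelBaseChange B C E E Q).symm.restrictScalars B
  have hτ (Q : Type u) [AddCommGroup Q] [Module B Q] (q : Q) : τ Q q = 1 ⊗ₜ (1 ⊗ₜ q) := by
    have h₁ : LinearEquiv.ofBijective (Algebra.linearMap B E) hE 1 = 1 := map_one (algebraMap B E)
    simp [τ, h₁]
  let d := τ M ≪≫ₗ δ.restrictScalars B ≪≫ₗ (τ M').symm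
  refine ⟨d, ?_⟩
  apply LinearEquiv.toLinearMap_injective
  ext m
  have : τ M' (d m) = δ (τ M m) := by simp [d]
  rw [hτ, hτ] at this
  simpa using this

theorem tensorMap_baseChange {C D E : Type u} [CommRing C] [CommRing D] [CommRing E]
    [Algebra C D] [Algebra C E] [Algebra D E] [IsScalarTower C D E] {P P' : Type u}
    [AddCommGroup P] [Module C P] [AddCommGroup P'] [Module C P'] (f : P ≃ₗ[C] P')
    (z : D ⊗[C] P) : tensorMap C D E P' (f.baseChange C D _ _ z) =
      f.baseChange C E _ _ (tensorMap C D E P z) := by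
  induction z with
  | zero => simp
  | tmul d q => simp
  | add x y hx hy => simp only [map_add, hx, hy]

/-- Stable extendedness of `D ⊗[C] P`, written in terms of modules over `C`. -/
theorem nonempty_equiv_of_stable {B C D : Type u} [CommRing B] [CommRing C] [CommRing D]
    [Algebra B C] [Algebra B D] [Algebra C D] [IsScalarTower B C D]
    {P N₁ N₂ : Type u} (N : Type u) [AddCommGroup P] [Module C P] [AddCommGroup N₁]
    [Module B N₁] [AddCommGroup N₂] [Module B N₂] [AddCommGroup N] [Module B N]
    (e : ((D ⊗[C] P) × (D ⊗[B] N₁)) ≃ₗ[D] D ⊗[B] N₂) :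
    Nonempty (D ⊗[C] (P × (C ⊗[B] (N₁ × N))) ≃ₗ[D] D ⊗[C] (C ⊗[B] (N₂ × N))) := by
  let k (L : Type u) [AddCommGroup L] [Module B L] :=
    TensorProduct.AlgebraTensorModule.cancelBaseChange B C D D L
  exact ⟨TensorProduct.prodRight C D D P _ ≪≫ₗ
    (LinearEquiv.refl D _).prodCongr (k _ ≪≫ₗ TensorProduct.prodRight B D D N₁ N) ≪≫ₗ
    (LinearEquiv.prodAssoc D _ _ _).symm ≪≫ₗ e.prodCongr (.refl D _) ≪≫ₗ
    (TensorProduct.prodRight B D D N₂ N).symm ≪≫ₗ (k _).symm⟩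

variable {B : Type u} [CommRing B] [Algebra B C] [Algebra B D₁] [Algebra B D₂] [Algebra B E]
  [IsScalarTower B C D₁] [IsScalarTower B C D₂] [IsScalarTower B C E]

include hsq in
/-- Milnor patching over a split fibre square `B → C ⇉ D₁, D₂ → E` with `B = E`. -/
theorem IsFibreProduct.K0Surjective (hE : Function.Bijective (algebraMap B E))
    (h₁ : K0Surjective B D₁) (h₂ : K0Surjective B D₂) : K0Surjective B C := by
  intro P _ _ _ _
  obtain ⟨N₁, N₂, _, _, _, _, _, _, _, _, ⟨e₁⟩⟩ := h₁ (D₁ ⊗[C] P)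
  obtain ⟨N₃, N₄, _, _, _, _, _, _, _, _, ⟨e₂⟩⟩ := h₂ (D₂ ⊗[C] P)
  obtain ⟨a⟩ := nonempty_equiv_of_stable N₃ e₁
  obtain ⟨b⟩ := nonempty_equiv_of_stable N₁ e₂
  let s : (P × (C ⊗[B] (N₁ × N₃))) ≃ₗ[C] (P × (C ⊗[B] (N₃ × N₁))) :=
    (LinearEquiv.refl C P).prodCongr ((LinearEquiv.prodComm B N₁ N₃).baseChange B C _ _)
  let b' := s.baseChange C D₂ _ _ ≪≫ₗ b
  obtain ⟨γa, hγa⟩ := exists_equiv_tensorMap (E := E) a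
  obtain ⟨γb, hγb⟩ := exists_equiv_tensorMap (E := E) b'
  obtain ⟨d, hd⟩ := exists_descent (B := B) hE (γb.symm ≪≫ₗ γa)
  obtain ⟨e⟩ := hsq.nonempty_equiv (P × (C ⊗[B] (N₁ × N₃))) (C ⊗[B] (N₂ × N₃)) a
    (b' ≪≫ₗ (d.baseChange B C _ _).baseChange C D₂ _ _) γa hγa fun z ↦ by
      rw [LinearEquiv.trans_apply, tensorMap_baseChange, hd, hγb]
      simp
  exact ⟨N₁ × N₃, N₂ × N₃, _, _, _, _, inferInstance, inferInstance, inferInstance, inferInstance,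
    ⟨e⟩⟩

end Milnor

section RingHomForm

variable {B C D₁ D₂ E R S T : Type u} [CommRing B] [CommRing C] [CommRing D₁] [CommRing D₂]
  [CommRing E] [CommRing R] [CommRing S] [CommRing T]

/-- Base change along the ring homomorphism `f` is surjective on `K₀`. -/
def RingHom.K0Surjective (f : R →+* S) : Prop :=
  @_root_.K0Surjective R S _ _ f.toAlgebra

theorem RingHom.k0Surjective_algebraMap [Algebra R S] :
    (algebraMap R S).K0Surjective ↔ _root_.K0Surjective R S := by
  rw [RingHom.K0Surjective, show (algebraMap R S).toAlgebra = ‹Algebra R S› from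
    Algebra.algebra_ext _ _ fun _ ↦ rfl]

theorem RingHom.K0Surjective.comp {f : R →+* S} {g : S →+* T} (hg : g.K0Surjective)
    (hf : f.K0Surjective) : (g.comp f).K0Surjective := by
  let _ := f.toAlgebra
  let _ := g.toAlgebra
  let _ := (g.comp f).toAlgebra
  have : IsScalarTower R S T := .of_algebraMap_eq fun _ ↦ rfl
  exact _root_.K0Surjective.trans hf hg

theorem RingHom.K0Surjective.of_comp {f : R →+* S} {g : S →+* T}
    (h : (g.comp f).K0Surjective) : g.K0Surjective := by
  let _ := f.toAlgebra
  let _ := g.toAlgebra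
  let _ := (g.comp f).toAlgebra
  have : IsScalarTower R S T := .of_algebraMap_eq fun _ ↦ rfl
  exact _root_.K0Surjective.of_tower S h

theorem RingHom.K0Surjective.of_bijective {f : R →+* S} (h : Function.Bijective f) :
    f.K0Surjective := by
  let _ := f.toAlgebra
  exact _root_.K0Surjective.of_bijective h

/-- A pullback square of rings `C ⇉ D₁, D₂ → E` together with `i : B → C` such that `B → E` is
bijective. -/
structure IsSplitSquare (i : B →+* C) (p : C →+* D₁) (q : C →+* D₂) (e₁ : D₁ →+* E)
    (e₂ : D₂ →+* E) : Prop where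
  comm : e₁.comp p = e₂.comp q
  bijective : Function.Bijective ((e₁.comp p).comp i)
  eq_zero : ∀ c, p c = 0 → q c = 0 → c = 0
  exists_lift : ∀ d₁ d₂, e₁ d₁ = e₂ d₂ → ∃ c, p c = d₁ ∧ q c = d₂

variable {i : B →+* C} {p : C →+* D₁} {q : C →+* D₂} {e₁ : D₁ →+* E} {e₂ : D₂ →+* E}

theorem IsSplitSquare.k0Surjective (h : IsSplitSquare i p q e₁ e₂)
    (h₁ : (p.comp i).K0Surjective) (h₂ : (q.comp i).K0Surjective) : i.K0Surjective := by
  let _ := i.toAlgebra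
  let _ := p.toAlgebra
  let _ := q.toAlgebra
  let _ := e₁.toAlgebra
  let _ := e₂.toAlgebra
  let _ := (p.comp i).toAlgebra
  let _ := (q.comp i).toAlgebra
  let _ := (e₁.comp p).toAlgebra
  let _ := ((e₁.comp p).comp i).toAlgebra
  have : IsScalarTower C D₁ E := .of_algebraMap_eq fun _ ↦ rfl
  have : IsScalarTower C D₂ E := .of_algebraMap_eq fun c ↦ RingHom.congr_fun h.comm c
  have : IsScalarTower B C D₁ := .of_algebraMap_eq fun _ ↦ rfl
  have : IsScalarTower B C D₂ := .of_algebraMap_eq fun _ ↦ rfl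
  have : IsScalarTower B C E := .of_algebraMap_eq fun _ ↦ rfl
  have hsq : IsFibreProduct C D₁ D₂ E := ⟨h.eq_zero, h.exists_lift⟩
  exact hsq.K0Surjective h.bijective h₁ h₂

theorem IsSplitSquare.polynomial (h : IsSplitSquare i p q e₁ e₂) :
    IsSplitSquare (mapRingHom i) (mapRingHom p) (mapRingHom q) (mapRingHom e₁)
      (mapRingHom e₂) where
  comm := by rw [mapRingHom_comp, mapRingHom_comp, h.comm]
  bijective := by
    rw [mapRingHom_comp, mapRingHom_comp]
    exact ⟨map_injective _ h.bijective.1, map_surjective _ h.bijective.2⟩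
  eq_zero c h₁ h₂ := by
    ext n
    refine h.eq_zero _ ?_ ?_
    · simpa using congrArg (coeff · n) h₁
    · simpa using congrArg (coeff · n) h₂
  exists_lift d₁ d₂ hd := by
    have hc (n : ℕ) : ∃ c, p c = d₁.coeff n ∧ q c = d₂.coeff n :=
      h.exists_lift _ _ (by simpa using congrArg (coeff · n) hd)
    choose c hc₁ hc₂ using hc
    let N := max d₁.natDegree d₂.natDegree + 1
    refine ⟨∑ n ∈ Finset.range N, monomial n (c n), ?_, ?_⟩
    · rw [d₁.as_sum_range' N (by lia)]
      simp [hc₁]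
    · rw [d₂.as_sum_range' N (by lia)]
      simp [hc₂]

end RingHomForm

section K0Regular

/-- `K₀(B) → K₀(B[X₁]) → ⋯ → K₀(B[X₁] ⋯ [Xₙ])` are all surjective. -/
def IsK0RegularUpTo : ℕ → (B : Type u) → [CommRing B] → Prop
  | 0, _, _ => True
  | n + 1, B, _ => (C : B →+* B[X]).K0Surjective ∧ IsK0RegularUpTo n B[X]

/-- Adjoining polynomial variables to `B` never creates new classes in `K₀`. -/
def IsK0Regular (B : Type u) [CommRing B] : Prop := ∀ n, IsK0RegularUpTo n B

variable {B : Type u} [CommRing B]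

theorem IsK0Regular.k0Surjective_C (h : IsK0Regular B) : (C : B →+* B[X]).K0Surjective := (h 1).1

theorem IsK0Regular.polynomial (h : IsK0Regular B) : IsK0Regular B[X] := fun n ↦ (h (n + 1)).2

theorem FiniteProjDim.isK0Regular [IsNoetherianRing B] (h : FiniteProjDim B) : IsK0Regular B := by
  intro n
  induction n generalizing B with
  | zero => trivial
  | succ n ih =>
    exact ⟨RingHom.k0Surjective_algebraMap.2 fun P _ _ _ _ ↦ h.isStablyExtended P, ih h.polynomial⟩

theorem IsSplitSquare.isK0Regular {C D₁ D₂ E : Type u} [CommRing C] [CommRing D₁] [CommRing D₂]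
    [CommRing E] {i : B →+* C} {p : C →+* D₁} {q : C →+* D₂} {e₁ : D₁ →+* E} {e₂ : D₂ →+* E}
    (h : IsSplitSquare i p q e₁ e₂) (h₁ : (p.comp i).K0Surjective) (h₂ : (q.comp i).K0Surjective)
    (hB : IsK0Regular B) (hD₁ : IsK0Regular D₁) (hD₂ : IsK0Regular D₂) : IsK0Regular C := by
  have key {S T : Type u} [CommRing S] [CommRing T] {f : S →+* T} (hf : f.K0Surjective)
      (hT : IsK0Regular T) : (mapRingHom f).K0Surjective := by
    refine .of_comp (f := Polynomial.C) ?_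
    rw [mapRingHom_comp_C]
    exact hT.k0Surjective_C.comp hf
  intro n
  induction n generalizing B C D₁ D₂ E with
  | zero => trivial
  | succ n ih =>
    have h₁' : ((mapRingHom p).comp (mapRingHom i)).K0Surjective := by
      rw [mapRingHom_comp]
      exact key h₁ hD₁
    have h₂' : ((mapRingHom q).comp (mapRingHom i)).K0Surjective := by
      rw [mapRingHom_comp]
      exact key h₂ hD₂
    refine ⟨.of_comp (f := i) ?_, ih h.polynomial h₁' h₂' hB.polynomial hD₁.polynomial
      hD₂.polynomial⟩
    rw [← mapRingHom_comp_C]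
    exact (h.polynomial.k0Surjective h₁' h₂').comp hB.k0Surjective_C

theorem IsK0Regular.of_bijective {C : Type u} [CommRing C] {f : B →+* C} (hB : IsK0Regular B)
    (hf : Function.Bijective f) : IsK0Regular C := by
  let e := RingEquiv.ofBijective f hf
  let g : C →+* B := e.symm
  have hg : g.comp f = .id B := RingHom.ext e.symm_apply_apply
  have h : IsSplitSquare f g g (.id B) (.id B) :=
    { comm := rfl
      bijective := by
        rw [RingHom.id_comp, hg]
        exact Function.bijective_id
      eq_zero := fun c hc _ ↦ by simpa [g] using hc
      exists_lift := fun d₁ d₂ hd ↦ ⟨f d₁, RingHom.congr_fun hg d₁, by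
        rw [show d₁ = d₂ from hd]
        exact RingHom.congr_fun hg d₂⟩ }
  have hid : (g.comp f).K0Surjective := by
    rw [hg]
    exact .of_bijective Function.bijective_id
  exact h.isK0Regular hid hid hB hB hB

end K0Regular

section CrossingRing

namespace CrossingRing

variable {R : Type u} [CommRing R] {r : ℕ} {S : Type u} [CommRing S] [Algebra R S]

variable (R) in
/-- The coordinate `t_{jk}` of the crossing ring. -/
noncomputable def var (j : Fin r) (k : Fin 2) : CrossingRing R r :=
  Ideal.Quotient.mk _ (MvPolynomial.X (j, k))

theorem var_mul_var (j : Fin r) : var R j 0 * var R j 1 = 0 := by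
  rw [var, var, ← map_mul, Ideal.Quotient.eq_zero_iff_mem]
  exact Ideal.subset_span ⟨j, rfl⟩

/-- The universal property of the crossing ring. -/
noncomputable def lift (v : Fin r → Fin 2 → S) (hv : ∀ j, v j 0 * v j 1 = 0) :
    CrossingRing R r →ₐ[R] S :=
  Ideal.Quotient.liftₐ _ (MvPolynomial.aeval fun x ↦ v x.1 x.2) fun a ha ↦ by
    rw [← RingHom.mem_ker]
    refine Ideal.span_le.2 ?_ ha
    rintro _ ⟨j, rfl⟩
    simp [hv]

@[simp] theorem lift_var (v : Fin r → Fin 2 → S) (hv : ∀ j, v j 0 * v j 1 = 0) (j : Fin r)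
    (k : Fin 2) : lift (R := R) v hv (var R j k) = v j k :=
  (Ideal.Quotient.lift_mk _ _ _).trans (MvPolynomial.aeval_X _ _)

theorem induction {motive : CrossingRing R r → Prop} (algebraMap : ∀ a, motive (algebraMap R _ a))
    (add : ∀ x y, motive x → motive y → motive (x + y))
    (mul_var : ∀ x j k, motive x → motive (x * var R j k)) (x : CrossingRing R r) : motive x := by
  obtain ⟨x, rfl⟩ := Ideal.Quotient.mk_surjective x
  induction x using MvPolynomial.induction_on with
  | C a => exact algebraMap a
  | add x y hx hy =>
    rw [map_add]
    exact add _ _ hx hy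
  | mul_X x j hx =>
    rw [map_mul]
    exact mul_var _ _ _ hx

theorem algebraMap_bijective_zero : Function.Bijective (algebraMap R (CrossingRing R 0)) := by
  let l : CrossingRing R 0 →ₐ[R] R := lift (fun _ _ ↦ 0) (by simp)
  refine ⟨fun a b h ↦ by simpa using congrArg l h, fun x ↦ ?_⟩
  induction x using induction with
  | algebraMap a => exact ⟨a, rfl⟩
  | add x y hx hy =>
    obtain ⟨a, rfl⟩ := hx
    obtain ⟨b, rfl⟩ := hy
    exact ⟨a + b, map_add _ _ _⟩
  | mul_var x j k hx => exact j.elim0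

variable (R r)

/-- The inclusion of the crossing ring in the next one. -/
noncomputable def incl : CrossingRing R r →ₐ[R] CrossingRing R (r + 1) :=
  lift (fun j k ↦ var R j.castSucc k) fun j ↦ var_mul_var j.castSucc

/-- The restriction to the `k`-th branch of the last crossing. -/
noncomputable def branch (k : Fin 2) : CrossingRing R (r + 1) →ₐ[R] (CrossingRing R r)[X] :=
  lift (fun j l ↦ Fin.lastCases (motive := fun _ ↦ (CrossingRing R r)[X])
    (if l = k then X else 0) (fun j ↦ C (var R j l)) j) fun j ↦ by
    cases j using Fin.lastCases with
    | last => fin_cases k <;> simp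
    | cast j => simp [← map_mul, var_mul_var]

@[simp] theorem incl_var (j : Fin r) (k : Fin 2) : incl R r (var R j k) = var R j.castSucc k := by
  simp [incl]

@[simp] theorem branch_var_castSucc (k : Fin 2) (j : Fin r) (l : Fin 2) :
    branch R r k (var R j.castSucc l) = C (var R j l) := by
  simp [branch]

@[simp] theorem branch_var_last (k l : Fin 2) :
    branch R r k (var R (Fin.last r) l) = if l = k then X else 0 := by
  simp [branch]

theorem branch_comp_incl (k : Fin 2) :
    ((branch R r k : CrossingRing R (r + 1) →+* (CrossingRing R r)[X]).comp
      (incl R r : CrossingRing R r →+* CrossingRing R (r + 1))) = C := by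
  refine RingHom.ext fun x ↦ ?_
  rw [RingHom.comp_apply, RingHom.coe_coe, RingHom.coe_coe]
  induction x using induction with
  | algebraMap a => rw [AlgHom.commutes, AlgHom.commutes, Polynomial.algebraMap_apply]
  | add x y hx hy => simp only [map_add, hx, hy]
  | mul_var x j k hx => simp only [map_mul, hx, incl_var, branch_var_castSucc]

@[simp] theorem branch_incl (k : Fin 2) (b : CrossingRing R r) :
    branch R r k (incl R r b) = C b :=
  RingHom.congr_fun (branch_comp_incl R r k) b

/-- The section of `branch`. -/
noncomputable def extend (k : Fin 2) : (CrossingRing R r)[X] →+* CrossingRing R (r + 1) :=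
  eval₂RingHom (incl R r : CrossingRing R r →+* CrossingRing R (r + 1)) (var R (Fin.last r) k)

@[simp] theorem branch_extend_self (k : Fin 2) (f : (CrossingRing R r)[X]) :
    branch R r k (extend R r k f) = f := by
  have h : (branch R r k : CrossingRing R (r + 1) →+* (CrossingRing R r)[X]).comp (extend R r k) =
      .id _ := by
    ext x
    all_goals simp [extend]
  exact RingHom.congr_fun h f

theorem branch_extend_of_ne {k l : Fin 2} (h : k ≠ l) (f : (CrossingRing R r)[X]) :
    branch R r l (extend R r k f) = C (f.eval 0) := by
  have h : (branch R r l : CrossingRing R (r + 1) →+* _).comp (extend R r k) =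
      C.comp (evalRingHom 0) := by
    ext x
    all_goals simp [extend, h]
  exact RingHom.congr_fun h f

theorem exists_eq_extend_add (c : CrossingRing R (r + 1)) : ∃ f g : (CrossingRing R r)[X],
    c = extend R r 0 f + var R (Fin.last r) 1 * extend R r 1 g := by
  have hxy : var R (Fin.last r) 0 * var R (Fin.last r) 1 = 0 := var_mul_var _
  induction c using induction with
  | algebraMap a =>
    refine ⟨C (algebraMap R _ a), 0, ?_⟩
    simp [extend]
  | add x y hx hy =>
    obtain ⟨f, g, rfl⟩ := hx
    obtain ⟨f', g', rfl⟩ := hy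
    exact ⟨f + f', g + g', by simp only [map_add]; ring⟩
  | mul_var x j k hx =>
    obtain ⟨f, g, rfl⟩ := hx
    cases j using Fin.lastCases with
    | last =>
      by_cases hk : k = 0
      · subst hk
        refine ⟨f * X, 0, ?_⟩
        have hX : extend R r 0 X = var R (Fin.last r) 0 := by simp [extend]
        rw [map_mul, map_zero, hX]
        linear_combination extend R r 1 g * hxy
      · obtain rfl : k = 1 := by lia
        refine ⟨0, C (f.coeff 0) + g * X, ?_⟩
        have hX (l : Fin 2) : extend R r l X = var R (Fin.last r) l := by simp [extend]
        have hC (l : Fin 2) (b) : extend R r l (C b) = incl R r b := by simp [extend]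
        conv_lhs => rw [← divX_mul_X_add f]
        simp only [map_add, map_mul, map_zero, hX, hC]
        linear_combination extend R r 0 f.divX * hxy
    | cast j =>
      refine ⟨f * C (var R j k), g * C (var R j k), ?_⟩
      have hC (l : Fin 2) : extend R r l (C (var R j k)) = var R j.castSucc k := by simp [extend]
      simp only [map_mul, hC]
      ring

theorem isSplitSquare : IsSplitSquare (B := CrossingRing R r) (C := CrossingRing R (r + 1))
    (D₁ := (CrossingRing R r)[X]) (D₂ := (CrossingRing R r)[X]) (E := CrossingRing R r)
    (incl R r) (branch R r 0) (branch R r 1) (evalRingHom 0) (evalRingHom 0) where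
  comm := by
    refine RingHom.ext fun c ↦ ?_
    obtain ⟨f, g, rfl⟩ := exists_eq_extend_add R r c
    simp [branch_extend_of_ne]
  bijective := by
    rw [RingHom.comp_assoc, branch_comp_incl]
    convert Function.bijective_id
    ext b
    simp
  eq_zero c h₁ h₂ := by
    obtain ⟨f, g, rfl⟩ := exists_eq_extend_add R r c
    have hf : f = 0 := by simpa using h₁
    subst hf
    have hg : X * g = 0 := by simpa using h₂
    rw [(isRegular_X (R := CrossingRing R r)).left.mul_left_eq_zero_iff] at hg
    simp [hg]
  exists_lift d₁ d₂ hd := by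
    have hd' : d₁.eval 0 = d₂.eval 0 := hd
    refine ⟨extend R r 0 d₁ + var R (Fin.last r) 1 * extend R r 1 d₂.divX, ?_, ?_⟩
    · simp
    · simp only [RingHom.coe_coe, map_add, map_mul, branch_extend_self, branch_var_last, if_pos,
        branch_extend_of_ne R r (zero_ne_one), hd', ← coeff_zero_eq_eval_zero]
      rw [add_comm, X_mul_divX_add]

theorem isK0Regular_and_k0Surjective (h : IsK0Regular R) : IsK0Regular (CrossingRing R r) ∧
    (algebraMap R (CrossingRing R r)).K0Surjective := by
  induction r with
  | zero =>
    exact ⟨h.of_bijective algebraMap_bijective_zero, .of_bijective algebraMap_bijective_zero⟩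
  | succ r ih =>
    have hb (k : Fin 2) : RingHom.K0Surjective (R := CrossingRing R r) (S := (CrossingRing R r)[X])
        ((branch R r k : CrossingRing R (r + 1) →+* (CrossingRing R r)[X]).comp
          (incl R r : CrossingRing R r →+* CrossingRing R (r + 1))) := by
      rw [branch_comp_incl]
      exact ih.1.k0Surjective_C
    refine ⟨(isSplitSquare R r).isK0Regular (hb 0) (hb 1) ih.1 ih.1.polynomial ih.1.polynomial, ?_⟩
    rw [← AlgHom.comp_algebraMap (incl R r)]
    exact ((isSplitSquare R r).k0Surjective (hb 0) (hb 1)).comp ih.2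

end CrossingRing

end CrossingRing

section K0

variable (R S : Type u) [CommRing R] [CommRing S] [Algebra R S]

variable {R} in
/-- The base change of a finitely generated projective module. -/
noncomputable def FGProjCl.baseChange (N : FGProjCl R) : FGProjCl S :=
  ⟨ModuleCat.of S (S ⊗[R] (N.1 : Type u)),
    have := N.2.1
    have := N.2.2
    ⟨inferInstanceAs (Module.Finite S (S ⊗[R] (N.1 : Type u))),
      inferInstanceAs (Module.Projective S (S ⊗[R] (N.1 : Type u)))⟩⟩

variable {R} in
theorem K0.cls_eq_add {M N P : FGProjCl R}
    (e : (P.1 : Type u) ≃ₗ[R] ((M.1 : Type u) × (N.1 : Type u))) :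
    K0.cls R P = K0.cls R M + K0.cls R N := by
  have h : (QuotientAddGroup.mk (FreeAbelianGroup.of P - FreeAbelianGroup.of M -
      FreeAbelianGroup.of N) : K0 R) = 0 :=
    (QuotientAddGroup.eq_zero_iff _).2 (AddSubgroup.subset_closure ⟨M, N, P, ⟨e⟩, rfl⟩)
  rw [QuotientAddGroup.mk_sub, QuotientAddGroup.mk_sub, sub_sub, sub_eq_zero] at h
  exact h

/-- Base change on `K₀`. -/
noncomputable def K0.map : K0 R →+ K0 S :=
  QuotientAddGroup.lift (K0Rels R)
    (FreeAbelianGroup.lift fun N ↦ K0.cls S (N.baseChange S)) <| by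
    rw [K0Rels, AddSubgroup.closure_le]
    rintro _ ⟨M, N, P, ⟨e⟩, rfl⟩
    have h := K0.cls_eq_add (M := M.baseChange S) (N := N.baseChange S) (P := P.baseChange S)
      (e.baseChange R S _ _ ≪≫ₗ TensorProduct.prodRight R S S _ _)
    simp [h]

variable {R} in
theorem K0.map_cls (N : FGProjCl R) : K0.map R S (K0.cls R N) = K0.cls S (N.baseChange S) := by
  simp [K0.map, K0.cls]

variable {R S} in
theorem K0Surjective.map_surjective (h : K0Surjective R S) :
    Function.Surjective (K0.map R S) := by
  rw [← AddMonoidHom.range_eq_top, eq_top_iff]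
  rintro x -
  induction x using QuotientAddGroup.induction_on with | H x => ?_
  have hP (P : FGProjCl S) : K0.cls S P ∈ (K0.map R S).range := by
    have := P.2.1
    have := P.2.2
    obtain ⟨N₁, N₂, _, _, _, _, h₁, h₂, h₃, h₄, ⟨e⟩⟩ := h P.1
    let M₁ : FGProjCl R := ⟨ModuleCat.of R N₁, h₁, h₂⟩
    let M₂ : FGProjCl R := ⟨ModuleCat.of R N₂, h₃, h₄⟩
    have he := K0.cls_eq_add (M := P) (N := M₁.baseChange S) (P := M₂.baseChange S) e.symm
    refine ⟨K0.cls R M₂ - K0.cls R M₁, ?_⟩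
    rw [map_sub, K0.map_cls, K0.map_cls, he, add_sub_cancel_right]
  induction x using FreeAbelianGroup.induction_on with
  | zero => exact zero_mem _
  | of P => exact hP P
  | neg P _ => exact neg_mem (hP P)
  | add x y hx hy => exact add_mem hx hy

end K0

end K0BaseChange

/-- Let `R` be a commutative Noetherian regular ring and
`A = A¹ ⊗_R ⋯ ⊗_R A^r` with `A^i = R[t_{i1}, t_{i2}]/(t_{i1}t_{i2})`.  Then the base-change
map `K₀(R) → K₀(A)` is surjective. -/
theorem K0_crossing_surjective (R : Type u) [CommRing R]
    [IsNoetherianRing R]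
    (hreg : ∀ M : ModuleCat.{u} R, Module.Finite R M → ∃ n : ℕ, HasFPD R n M)
    (r : ℕ) :
    ∃ φ : K0 R →+ K0 (CrossingRing R r),
      Function.Surjective φ ∧
      ∀ (N : FGProjCl R)
        (h : IsFGProj (CrossingRing R r)
          (ModuleCat.of (CrossingRing R r) (TensorProduct R (CrossingRing R r) (N.1 : Type u)))),
        φ (K0.cls R N) = K0.cls (CrossingRing R r)
          ⟨ModuleCat.of (CrossingRing R r)
            (TensorProduct R (CrossingRing R r) (N.1 : Type u)), h⟩ := by
  have hR : IsK0Regular R := FiniteProjDim.isK0Regular fun M _ _ _ ↦ by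
    obtain ⟨n, hn⟩ := hreg (ModuleCat.of R M) ‹_›
    exact ⟨n + 1, hn.hasProjectiveDimensionLT⟩
  have hA := RingHom.k0Surjective_algebraMap.1 (CrossingRing.isK0Regular_and_k0Surjective R r hR).2
  exact ⟨K0.map R (CrossingRing R r), hA.map_surjective, fun N _ ↦ K0.map_cls _ N⟩
end
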